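/- Let p be a prime and ψ : F_p → ℂˣ a nontrivial additive character. Let χ₁, χ₂ : F_{p^4}ˣ → ℂˣ be regular multiplicative characters such that G(χ₁·η, ψ) = G(χ₂·η, ψ) for every multiplicative character η : F_pˣ → ℂˣ. Then there exists an integer j such that χ₁(x) = χ₂(x^(p^j)) for all x ∈ F_{p^4}ˣ. -/

import Mathlib

open scoped Classical

/-- The Gauss sum over `E` of the character `χ` twisted by the character `η` of the
base field `F` (pulled back via the norm map), with respect to the additive
character `ψ` of `F` (composed with the trace map):
`G(χ·η, ψ) = ∑_{x ∈ Eˣ} χ(x) η(Nm(x)) ψ(Tr(x))`. -/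
noncomputable def twistedGaussSum (F : Type) {E : Type} [Field F] [Field E] [Fintype F]
    [Fintype E] [Algebra F E] (χ : Eˣ →* ℂˣ) (η : Fˣ →* ℂˣ) (ψ : AddChar F ℂ) : ℂ :=
  ∑ x : Eˣ, ((χ x : ℂ) * (η (Units.map (Algebra.norm F : E →* F) x) : ℂ)) *
    ψ (Algebra.trace F E (x : E))

/-- A multiplicative character `χ` of `Eˣ` is *regular* if it does not factor through
the norm map to any proper subfield of `E`. -/
def IsRegularChar {E : Type} [Field E] [Fintype E] (χ : Eˣ →* ℂˣ) : Prop :=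
  ∀ K : Subfield E, K ≠ ⊤ →
    ¬ ∃ η : Kˣ →* ℂˣ, ∀ x : Eˣ, χ x = η (Units.map (Algebra.norm K : E →* K) x)

/-- `X i` is the `i`-th cyclic shift of the base `p` expansion with digits `a`, written with
`N = (p ^ 4 - 1) / (p - 1)`, and the four shifts are distinct. -/
structure DigitOrbit (p N : ℤ) (a X : Fin 4 → ℤ) : Prop where
  two_le : 2 ≤ p
  N_pos : 0 < N
  step : ∀ i, p * X i = a i * ((p - 1) * N) + X (i + 1)
  pos : ∀ i, 0 < X i
  lt : ∀ i, X i < (p - 1) * N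
  ne_succ : ∀ i, X i ≠ X (i + 1)
  ne_add_two : ∀ i, X i ≠ X (i + 2)

/-- The integer part of `X i / N` for a digit orbit. -/
def lowDigit (a X : Fin 4 → ℤ) (i : Fin 4) : ℤ :=
  a i - if X (i + 1) < X i then 1 else 0

/-- The digit sums and the products of factorials of digits agree, modulo `p` for the latter,
for all simultaneous translates of two digit orbits by multiples of `N`. -/
def CutAgree (p : ℕ) (a t b s : Fin 4 → ℤ) : Prop :=
  ∀ l : ℤ, 0 ≤ l → l < p → ∀ u v c d : Fin 4 → ℤ,
    (∀ i, u i = 1 ∧ l ≤ t i ∨ u i = 0 ∧ t i < l) →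
    (∀ i, v i = 1 ∧ l ≤ s i ∨ v i = 0 ∧ s i < l) →
    (∀ i, c i = a i - l + p * (1 - u i) - (1 - u (i + 1))) →
    (∀ i, d i = b i - l + p * (1 - v i) - (1 - v (i + 1))) →
    ∑ i, c i = ∑ i, d i ∧
      ∏ i, (c i).toNat.factorial ≡ ∏ i, (d i).toNat.factorial [MOD p]

namespace DigitOrbit

variable {p N : ℤ} {a X : Fin 4 → ℤ}

theorem digit_bounds {Q x y c : ℤ} (hx : 0 < x) (hxQ : x < Q) (hy : 0 < y) (hyQ : y < Q)
    (hp : 2 ≤ p) (h : p * x = c * Q + y) : 0 ≤ c ∧ c < p := by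
  constructor
  · by_contra hc
    have : c ≤ -1 := by omega
    nlinarith
  · by_contra hc
    have : p ≤ c := by omega
    nlinarith

theorem lowDigit_bounds (h : DigitOrbit p N a X) (i : Fin 4) :
    lowDigit a X i * N < X i ∧ X i < (lowDigit a X i + 1) * N := by
  have h1 := h.step i
  have h2 := h.pos i
  have h3 := h.lt i
  have h4 := h.pos (i + 1)
  have h5 := h.lt (i + 1)
  have h6 := h.ne_succ i
  have h7 := h.two_le
  have hp : (0 : ℤ) < p - 1 := by omega
  unfold lowDigit
  split_ifs with hlt
  · constructor <;> refine lt_of_mul_lt_mul_left (a := p - 1) ?_ hp.le <;> linarith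
  · have : X i < X (i + 1) := by omega
    constructor <;> refine lt_of_mul_lt_mul_left (a := p - 1) ?_ hp.le <;> linarith

theorem lowDigit_range (h : DigitOrbit p N a X) (i : Fin 4) :
    0 ≤ lowDigit a X i ∧ lowDigit a X i ≤ p - 2 := by
  obtain ⟨h1, h2⟩ := h.lowDigit_bounds i
  have h3 := h.pos i
  have h4 := h.lt i
  have h5 := h.N_pos
  constructor
  · have : 0 < lowDigit a X i + 1 := by
      by_contra hc
      nlinarith
    omega
  · have : lowDigit a X i < p - 1 := by
      by_contra hc
      nlinarith
    omega

theorem lowDigit_mono (h : DigitOrbit p N a X) {i j : Fin 4} (hij : X i < X j) :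
    lowDigit a X i ≤ lowDigit a X j := by
  have h1 := h.lowDigit_bounds i
  have h2 := h.lowDigit_bounds j
  have h5 := h.N_pos
  by_contra hc
  have : lowDigit a X j + 1 ≤ lowDigit a X i := by omega
  nlinarith

theorem digit_mono (h : DigitOrbit p N a X) {i j : Fin 4} (hij : X i < X j) : a i ≤ a j := by
  have h1 := h.step i
  have h2 := h.step j
  have h3 := h.pos (i + 1)
  have h4 := h.lt (j + 1)
  have h7 := h.two_le
  by_contra hc
  have : a j + 1 ≤ a i := by omega
  have h8 := h.N_pos
  nlinarith [mul_pos (show 0 < p - 1 by omega) h8]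

theorem digit_strictMono (h : DigitOrbit p N a X) {i j : Fin 4} (hij : X i < X j)
    (hij' : X (j + 1) < X (i + 1)) : a i < a j := by
  have h1 := h.step i
  have h2 := h.step j
  have h7 := h.two_le
  by_contra hc
  have : a j ≤ a i := by omega
  have h8 := h.N_pos
  nlinarith [mul_pos (show 0 < p - 1 by omega) h8]

theorem rotate (h : DigitOrbit p N a X) (r : Fin 4) :
    DigitOrbit p N (fun i => a (i + r)) (fun i => X (i + r)) where
  two_le := h.two_le
  N_pos := h.N_pos
  step i := by rw [add_right_comm]; exact h.step (i + r)
  pos i := h.pos _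
  lt i := h.lt _
  ne_succ i := by rw [add_right_comm]; exact h.ne_succ (i + r)
  ne_add_two i := by rw [add_right_comm]; exact h.ne_add_two (i + r)

theorem lowDigit_rotate (r : Fin 4) :
    lowDigit (fun i => a (i + r)) (fun i => X (i + r)) = fun i => lowDigit a X (i + r) := by
  funext i
  simp only [lowDigit, add_right_comm i 1 r]

end DigitOrbit

theorem CutAgree.symm {p : ℕ} {a t b s : Fin 4 → ℤ} (h : CutAgree p a t b s) :
    CutAgree p b s a t := fun l h0 h1 u v c d hu hv hc hd =>
  let H := h l h0 h1 v u d c hv hu hd hc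
  ⟨H.1.symm, H.2.symm⟩

theorem CutAgree.rotate {p : ℕ} {a t b s : Fin 4 → ℤ} (h : CutAgree p a t b s) (r q : Fin 4) :
    CutAgree p (fun i => a (i + r)) (fun i => t (i + r)) (fun i => b (i + q))
      (fun i => s (i + q)) := by
  intro l h0 h1 u v c d hu hv hc hd
  have H := h l h0 h1 (fun i => u (i - r)) (fun i => v (i - q)) (fun i => c (i - r))
    (fun i => d (i - q)) (fun i => by simpa using hu (i - r)) (fun i => by simpa using hv (i - q))
    (fun i => by simpa [sub_add_eq_add_sub] using hc (i - r))
    (fun i => by simpa [sub_add_eq_add_sub] using hd (i - q))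
  have e₁ : ∑ i, c (i - r) = ∑ i, c i := Equiv.sum_comp (Equiv.subRight r) c
  have e₂ : ∑ i, d (i - q) = ∑ i, d i := Equiv.sum_comp (Equiv.subRight q) d
  have e₃ : ∏ i, (c (i - r)).toNat.factorial = ∏ i, (c i).toNat.factorial :=
    Equiv.prod_comp (Equiv.subRight r) fun i => (c i).toNat.factorial
  have e₄ : ∏ i, (d (i - q)).toNat.factorial = ∏ i, (d i).toNat.factorial :=
    Equiv.prod_comp (Equiv.subRight q) fun i => (d i).toNat.factorial
  rwa [e₁, e₂, e₃, e₄] at H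

/-- The digits `a` and their low digits `t`, in terms of the sorted low digits `q₁, …, q₄`, for
the six possible orders of a digit orbit that starts at its minimum. -/
def HasOrderType (n : ℕ) (q₁ q₂ q₃ q₄ : ℤ) (a t : Fin 4 → ℤ) : Prop :=
  match n with
  | 0 => q₂ < q₃ ∧ t = ![q₁, q₃, q₄, q₂] ∧ a = ![q₁, q₃, q₄ + 1, q₂ + 1]
  | 1 => q₃ < q₄ ∧ t = ![q₁, q₃, q₂, q₄] ∧ a = ![q₁, q₃ + 1, q₂, q₄ + 1]
  | 2 => t = ![q₁, q₂, q₄, q₃] ∧ a = ![q₁, q₂, q₄ + 1, q₃ + 1]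
  | 3 => q₁ < q₂ ∧ t = ![q₁, q₄, q₂, q₃] ∧ a = ![q₁, q₄ + 1, q₂, q₃ + 1]
  | 4 => t = ![q₁, q₂, q₃, q₄] ∧ a = ![q₁, q₂, q₃, q₄ + 1]
  | _ => t = ![q₁, q₄, q₃, q₂] ∧ a = ![q₁, q₄ + 1, q₃ + 1, q₂ + 1]

theorem vec4_eq {f : Fin 4 → ℤ} {x y z w : ℤ} (h0 : f 0 = x) (h1 : f 1 = y) (h2 : f 2 = z)
    (h3 : f 3 = w) : f = ![x, y, z, w] := by
  subst h0 h1 h2 h3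
  funext i
  fin_cases i <;> rfl

theorem DigitOrbit.exists_orderType {p N : ℤ} {a X : Fin 4 → ℤ} (h : DigitOrbit p N a X)
    (hmin : ∀ i, i ≠ 0 → X 0 < X i) :
    ∃ n < 6, ∃ q₁ q₂ q₃ q₄, 0 ≤ q₁ ∧ q₁ ≤ q₂ ∧ q₂ ≤ q₃ ∧ q₃ ≤ q₄ ∧ q₄ ≤ p - 2 ∧
      HasOrderType n q₁ q₂ q₃ q₄ a (lowDigit a X) := by
  have m1 := hmin 1 (by decide)
  have m2 := hmin 2 (by decide)
  have m3 := hmin 3 (by decide)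
  have n12 : X 1 ≠ X 2 := h.ne_succ 1
  have n23 : X 2 ≠ X 3 := h.ne_succ 2
  have n13 : X 1 ≠ X 3 := h.ne_add_two 1
  have r0 := h.lowDigit_range 0
  have r1 := h.lowDigit_range 1
  have r2 := h.lowDigit_range 2
  have r3 := h.lowDigit_range 3
  have t0 : lowDigit a X 0 = a 0 - if X 1 < X 0 then 1 else 0 := rfl
  have t1 : lowDigit a X 1 = a 1 - if X 2 < X 1 then 1 else 0 := rfl
  have t2 : lowDigit a X 2 = a 2 - if X 3 < X 2 then 1 else 0 := rfl
  have t3 : lowDigit a X 3 = a 3 - if X 0 < X 3 then 1 else 0 := rfl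
  rw [if_neg (by omega)] at t0
  rw [if_pos (by omega)] at t3
  have k1 := h.lowDigit_mono m1
  have k2 := h.lowDigit_mono m2
  have k3 := h.lowDigit_mono m3
  rcases lt_or_gt_of_ne n12 with l12 | l12 <;> rcases lt_or_gt_of_ne n23 with l23 | l23 <;>
    rcases lt_or_gt_of_ne n13 with l13 | l13 <;> try (exfalso; omega)
  all_goals have j12 := h.lowDigit_mono l12
  all_goals have j23 := h.lowDigit_mono l23
  all_goals have j13 := h.lowDigit_mono l13
  · rw [if_neg (by omega)] at t1 t2
    exact ⟨4, by omega, _, _, _, _, r0.1, k1, j12, j23, r3.2, vec4_eq rfl rfl rfl rfl,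
      vec4_eq (by omega) (by omega) (by omega) (by omega)⟩
  · rw [if_neg (by omega)] at t1
    rw [if_pos (by omega)] at t2
    exact ⟨2, by omega, _, _, _, _, r0.1, k1, j13, j23, r2.2, vec4_eq rfl rfl rfl rfl,
      vec4_eq (by omega) (by omega) (by omega) (by omega)⟩
  · rw [if_neg (by omega)] at t1
    rw [if_pos (by omega)] at t2
    have := h.digit_mono l13
    exact ⟨0, by omega, _, _, _, _, r0.1, k3, j13, j12, r2.2, by omega, vec4_eq rfl rfl rfl rfl,
      vec4_eq (by omega) (by omega) (by omega) (by omega)⟩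
  · rw [if_pos (by omega)] at t1
    rw [if_neg (by omega)] at t2
    have := h.digit_strictMono l13 (show X 0 < X 2 from m2)
    exact ⟨1, by omega, _, _, _, _, r0.1, k2, j12, j13, r3.2, by omega, vec4_eq rfl rfl rfl rfl,
      vec4_eq (by omega) (by omega) (by omega) (by omega)⟩
  · rw [if_pos (by omega)] at t1
    rw [if_neg (by omega)] at t2
    have := h.digit_strictMono m2 (show X 3 < X 1 from l13)
    exact ⟨3, by omega, _, _, _, _, r0.1, k2, j23, j13, r1.2, by omega, vec4_eq rfl rfl rfl rfl,
      vec4_eq (by omega) (by omega) (by omega) (by omega)⟩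
  · rw [if_pos (by omega)] at t1 t2
    exact ⟨5, by omega, _, _, _, _, r0.1, k3, j23, j12, r1.2, vec4_eq rfl rfl rfl rfl,
      vec4_eq (by omega) (by omega) (by omega) (by omega)⟩

theorem HasOrderType.sum_comp {n : ℕ} {q₁ q₂ q₃ q₄ : ℤ} {a t : Fin 4 → ℤ}
    (h : HasOrderType n q₁ q₂ q₃ q₄ a t) (f : ℤ → ℤ) :
    ∑ i, f (t i) = f q₁ + f q₂ + f q₃ + f q₄ := by
  match n with
  | 0 => obtain ⟨-, rfl, -⟩ := h; simp only [Fin.sum_univ_four, Matrix.cons_val]; ring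
  | 1 => obtain ⟨-, rfl, -⟩ := h; simp only [Fin.sum_univ_four, Matrix.cons_val]; ring
  | 2 => obtain ⟨rfl, -⟩ := h; simp only [Fin.sum_univ_four, Matrix.cons_val]; ring
  | 3 => obtain ⟨-, rfl, -⟩ := h; simp only [Fin.sum_univ_four, Matrix.cons_val]; ring
  | 4 => obtain ⟨rfl, -⟩ := h; simp only [Fin.sum_univ_four, Matrix.cons_val]
  | n + 5 => obtain ⟨rfl, -⟩ := h; simp only [Fin.sum_univ_four, Matrix.cons_val]; ring

theorem eq_of_sum_indicator_eq {m x₁ x₂ x₃ x₄ y₁ y₂ y₃ y₄ : ℤ} (hx : 0 ≤ x₁) (hx₁ : x₁ ≤ x₂)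
    (hx₂ : x₂ ≤ x₃) (hx₃ : x₃ ≤ x₄) (hxm : x₄ < m) (hy : 0 ≤ y₁) (hy₁ : y₁ ≤ y₂)
    (hy₂ : y₂ ≤ y₃) (hy₃ : y₃ ≤ y₄) (hym : y₄ < m)
    (h : ∀ l : ℤ, 0 ≤ l → l < m →
      ((if l ≤ x₁ then 1 else 0) + (if l ≤ x₂ then 1 else 0) + (if l ≤ x₃ then 1 else 0) +
        (if l ≤ x₄ then 1 else 0) : ℤ) =
      (if l ≤ y₁ then 1 else 0) + (if l ≤ y₂ then 1 else 0) + (if l ≤ y₃ then 1 else 0) +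
        (if l ≤ y₄ then 1 else 0)) :
    x₁ = y₁ ∧ x₂ = y₂ ∧ x₃ = y₃ ∧ x₄ = y₄ := by
  have a1 := h x₁ (by omega) (by omega)
  have a2 := h x₂ (by omega) (by omega)
  have a3 := h x₃ (by omega) (by omega)
  have a4 := h x₄ (by omega) (by omega)
  have b1 := h y₁ (by omega) (by omega)
  have b2 := h y₂ (by omega) (by omega)
  have b3 := h y₃ (by omega) (by omega)
  have b4 := h y₄ (by omega) (by omega)
  clear h
  refine ⟨?_, ?_, ?_, ?_⟩
  · clear a2 a3 a4 b2 b3 b4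
    rcases lt_trichotomy x₁ y₁ with h | h | h
    · split_ifs at b1 <;> omega
    · exact h
    · split_ifs at a1 <;> omega
  · clear a1 a3 a4 b1 b3 b4
    rcases lt_trichotomy x₂ y₂ with h | h | h
    · split_ifs at b2 <;> omega
    · exact h
    · split_ifs at a2 <;> omega
  · clear a1 a2 a4 b1 b2 b4
    rcases lt_trichotomy x₃ y₃ with h | h | h
    · split_ifs at b3 <;> omega
    · exact h
    · split_ifs at a3 <;> omega
  · clear a1 a2 a3 b1 b2 b3
    rcases lt_trichotomy x₄ y₄ with h | h | h
    · split_ifs at b4 <;> omega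
    · exact h
    · split_ifs at a4 <;> omega

theorem CutAgree.sum_digits_eq {p : ℕ} {a t b s : Fin 4 → ℤ} (h : CutAgree p a t b s) {l : ℤ}
    (h0 : 0 ≤ l) (h1 : l < p) :
    ∑ i, a i - (p - 1) * ∑ i, (if l ≤ t i then (1 : ℤ) else 0) =
      ∑ i, b i - (p - 1) * ∑ i, (if l ≤ s i then (1 : ℤ) else 0) := by
  have H := (h l h0 h1 (fun i => if l ≤ t i then (1 : ℤ) else 0)
    (fun i => if l ≤ s i then (1 : ℤ) else 0) _ _
    (fun i => by split_ifs <;> omega) (fun i => by split_ifs <;> omega)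
    (fun i => rfl) (fun i => rfl)).1
  have e : ∀ f g : Fin 4 → ℤ, ∑ i, (f i - l + p * (1 - g i) - (1 - g (i + 1))) =
      ∑ i, f i - 4 * l + 4 * p - 4 - (p - 1) * ∑ i, g i := by
    intro f g
    have : ∑ i, g (i + 1) = ∑ i, g i := Equiv.sum_comp (Equiv.addRight (1 : Fin 4)) g
    simp only [Finset.sum_sub_distrib, Finset.sum_add_distrib, ← Finset.mul_sum, this]
    simp
    ring
  rw [e a, e b] at H
  linarith

theorem eq_of_factorial_mul_modEq {p : ℕ} (hp : p.Prime) {e f x y : ℤ} (he : 0 ≤ e) (hep : e < p)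
    (hf : 0 ≤ f) (hfp : f < p) (hx : 0 ≤ x) (hxp : x + 1 < p) (hy : 0 ≤ y) (hyp : y + 1 < p)
    (h : e.toNat.factorial * f.toNat.factorial * (x + 1).toNat.factorial * y.toNat.factorial ≡
      e.toNat.factorial * f.toNat.factorial * x.toNat.factorial * (y + 1).toNat.factorial [MOD p]) :
    x = y := by
  lift e to ℕ using he
  lift f to ℕ using hf
  lift x to ℕ using hx
  lift y to ℕ using hy
  have key : ∀ n : ℕ, (n : ℤ) < p → Nat.Coprime p n.factorial := fun n hn =>
    hp.coprime_factorial_of_lt (by omega)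
  have h1 : ((x : ℤ) + 1).toNat = x + 1 := by omega
  have h2 : ((y : ℤ) + 1).toNat = y + 1 := by omega
  simp only [h1, h2, Int.toNat_natCast, Nat.factorial_succ] at h
  have hc : Nat.gcd p (e.factorial * f.factorial * x.factorial * y.factorial) = 1 :=
    (((key e hep).mul_right (key f hfp)).mul_right (key x (by omega))).mul_right
      (key y (by omega))
  have h3 : x + 1 ≡ y + 1 [MOD p] := by
    refine Nat.ModEq.cancel_left_of_coprime hc ?_
    convert h using 1 <;> ring
  have h4 := Nat.ModEq.eq_of_lt_of_lt h3 (by omega) (by omega)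
  omega

theorem CutAgree.prod_vec {p : ℕ} {a₀ a₁ a₂ a₃ t₀ t₁ t₂ t₃ b₀ b₁ b₂ b₃ s₀ s₁ s₂ s₃ : ℤ}
    (h : CutAgree p ![a₀, a₁, a₂, a₃] ![t₀, t₁, t₂, t₃] ![b₀, b₁, b₂, b₃] ![s₀, s₁, s₂, s₃])
    {l : ℤ} (h0 : 0 ≤ l) (h1 : l < p) (u₀ u₁ u₂ u₃ v₀ v₁ v₂ v₃ c₀ c₁ c₂ c₃ d₀ d₁ d₂ d₃ : ℤ)
    (hu : (u₀ = 1 ∧ l ≤ t₀ ∨ u₀ = 0 ∧ t₀ < l) ∧ (u₁ = 1 ∧ l ≤ t₁ ∨ u₁ = 0 ∧ t₁ < l) ∧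
      (u₂ = 1 ∧ l ≤ t₂ ∨ u₂ = 0 ∧ t₂ < l) ∧ (u₃ = 1 ∧ l ≤ t₃ ∨ u₃ = 0 ∧ t₃ < l))
    (hv : (v₀ = 1 ∧ l ≤ s₀ ∨ v₀ = 0 ∧ s₀ < l) ∧ (v₁ = 1 ∧ l ≤ s₁ ∨ v₁ = 0 ∧ s₁ < l) ∧
      (v₂ = 1 ∧ l ≤ s₂ ∨ v₂ = 0 ∧ s₂ < l) ∧ (v₃ = 1 ∧ l ≤ s₃ ∨ v₃ = 0 ∧ s₃ < l))
    (hc : c₀ = a₀ - l + p * (1 - u₀) - (1 - u₁) ∧ c₁ = a₁ - l + p * (1 - u₁) - (1 - u₂) ∧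
      c₂ = a₂ - l + p * (1 - u₂) - (1 - u₃) ∧ c₃ = a₃ - l + p * (1 - u₃) - (1 - u₀))
    (hd : d₀ = b₀ - l + p * (1 - v₀) - (1 - v₁) ∧ d₁ = b₁ - l + p * (1 - v₁) - (1 - v₂) ∧
      d₂ = b₂ - l + p * (1 - v₂) - (1 - v₃) ∧ d₃ = b₃ - l + p * (1 - v₃) - (1 - v₀)) :
    c₀.toNat.factorial * c₁.toNat.factorial * c₂.toNat.factorial * c₃.toNat.factorial ≡
      d₀.toNat.factorial * d₁.toNat.factorial * d₂.toNat.factorial * d₃.toNat.factorial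
      [MOD p] := by
  have H := (h l h0 h1 ![u₀, u₁, u₂, u₃] ![v₀, v₁, v₂, v₃] ![c₀, c₁, c₂, c₃] ![d₀, d₁, d₂, d₃]
    (by intro i; fin_cases i; exacts [hu.1, hu.2.1, hu.2.2.1, hu.2.2.2])
    (by intro i; fin_cases i; exacts [hv.1, hv.2.1, hv.2.2.1, hv.2.2.2])
    (by intro i; fin_cases i; exacts [hc.1, hc.2.1, hc.2.2.1, hc.2.2.2])
    (by intro i; fin_cases i; exacts [hd.1, hd.2.1, hd.2.2.1, hd.2.2.2])).2
  simpa only [Fin.prod_univ_four, Matrix.cons_val] using H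

/-- The integer with base `p` digits `a 0, a 1, a 2, a 3`, the leading digit first. -/
def digitValue (p : ℤ) (a : Fin 4 → ℤ) : ℤ :=
  a 0 * p ^ 3 + a 1 * p ^ 2 + a 2 * p + a 3

/-- Some cyclic shifts of the digits `a` and `b` differ by `± (p - 1) * p ^ c`. -/
def ShiftClose (p : ℤ) (a b : Fin 4 → ℤ) : Prop :=
  ∃ r s : Fin 4, ∃ c < 4, ∃ ε : ℤ, (ε = 1 ∨ ε = -1) ∧
    digitValue p (fun i => a (i + r)) - digitValue p (fun i => b (i + s)) = ε * ((p - 1) * p ^ c)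

theorem ShiftClose.symm {p : ℤ} {a b : Fin 4 → ℤ} (h : ShiftClose p a b) : ShiftClose p b a := by
  obtain ⟨r, s, c, hc, ε, hε, h⟩ := h
  exact ⟨s, r, c, hc, -ε, by omega, by linarith⟩

theorem HasOrderType.shiftClose {p : ℕ} (hp : p.Prime) {m n : ℕ} (hmn : m < n) (hn : n < 6)
    {q₁ q₂ q₃ q₄ : ℤ} (h₁ : 0 ≤ q₁) (h₁₂ : q₁ ≤ q₂) (h₂₃ : q₂ ≤ q₃) (h₃₄ : q₃ ≤ q₄)
    (h₄ : q₄ ≤ p - 2) {a t b s : Fin 4 → ℤ} (ha : HasOrderType m q₁ q₂ q₃ q₄ a t)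
    (hb : HasOrderType n q₁ q₂ q₃ q₄ b s) (h : CutAgree p a t b s)
    (hsum : ∑ i, a i = ∑ i, b i) : 3 ≤ p ∧ ShiftClose p a b := by
  have key := @eq_of_factorial_mul_modEq p hp
  have hz : (0 : ℤ) < p := by have := hp.pos; omega
  interval_cases n <;> interval_cases m <;> simp only [HasOrderType] at ha hb
  · obtain ⟨hlt, rfl, rfl⟩ := ha
    obtain ⟨hlt', rfl, rfl⟩ := hb
    exfalso
    have H := h.prod_vec (l := 0) (by omega) (by omega) 1 1 1 1 1 1 1 1
      q₁ q₃ (q₄ + 1) (q₂ + 1)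
      q₁ (q₃ + 1) q₂ (q₄ + 1)
      (by omega) (by omega) (by refine ⟨?_, ?_, ?_, ?_⟩ <;> ring)
      (by refine ⟨?_, ?_, ?_, ?_⟩ <;> ring)
    have := key (e := q₁) (f := q₄ + 1) (x := q₂) (y := q₃) (by omega) (by omega) (by omega)
      (by omega) (by omega) (by omega) (by omega) (by omega)
      (by convert H using 1 <;> ring)
    omega
  · obtain ⟨hlt, rfl, rfl⟩ := ha
    obtain ⟨rfl, rfl⟩ := hb
    exfalso
    have H := h.prod_vec (l := 0) (by omega) (by omega) 1 1 1 1 1 1 1 1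
      q₁ q₃ (q₄ + 1) (q₂ + 1)
      q₁ q₂ (q₄ + 1) (q₃ + 1)
      (by omega) (by omega) (by refine ⟨?_, ?_, ?_, ?_⟩ <;> ring)
      (by refine ⟨?_, ?_, ?_, ?_⟩ <;> ring)
    have := key (e := q₁) (f := q₄ + 1) (x := q₂) (y := q₃) (by omega) (by omega) (by omega)
      (by omega) (by omega) (by omega) (by omega) (by omega)
      (by convert H using 1 <;> ring)
    omega
  · obtain ⟨hlt, rfl, rfl⟩ := ha
    obtain ⟨rfl, rfl⟩ := hb
    rcases h₁₂.lt_or_eq with h' | h'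
    · exfalso
      have H := h.prod_vec (l := q₂) (by omega) (by omega) 0 1 1 1 0 1 1 1
        (q₁ - q₂ + p) (q₃ - q₂ + 1) (q₂ - q₂) (q₄ - q₂)
        (q₁ - q₂ + p) (q₂ - q₂) (q₄ - q₂ + 1) (q₃ - q₂)
        (by omega) (by omega) (by refine ⟨?_, ?_, ?_, ?_⟩ <;> ring)
        (by refine ⟨?_, ?_, ?_, ?_⟩ <;> ring)
      have := key (e := q₁ - q₂ + p) (f := q₂ - q₂) (x := q₃ - q₂) (y := q₄ - q₂)
        (by omega) (by omega) (by omega) (by omega) (by omega) (by omega) (by omega) (by omega)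
        (by convert H using 1 <;> ring)
      omega
    rcases h₂₃.lt_or_eq with h'' | h''
    · exfalso
      have H := h.prod_vec (l := q₃) (by omega) (by omega) 0 1 0 1 0 0 1 1
        (q₁ - q₃ + p - 1 + 1) (q₃ - q₃) (q₂ - q₃ + p) (q₄ - q₃)
        (q₁ - q₃ + p - 1) (q₂ - q₃ + p) (q₄ - q₃ + 1) (q₃ - q₃)
        (by omega) (by omega) (by refine ⟨?_, ?_, ?_, ?_⟩ <;> ring)
        (by refine ⟨?_, ?_, ?_, ?_⟩ <;> ring)
      have := key (e := q₃ - q₃) (f := q₂ - q₃ + p) (x := q₁ - q₃ + p - 1) (y := q₄ - q₃)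
        (by omega) (by omega) (by omega) (by omega) (by omega) (by omega) (by omega) (by omega)
        (by convert H using 1 <;> ring)
      omega
    subst h' h''
    refine ⟨by omega, 0, 3, 2, by omega, -1, by omega, ?_⟩
    simp only [digitValue, zero_add, add_zero, Fin.reduceAdd, Matrix.cons_val]
    ring
  · obtain ⟨hlt, rfl, rfl⟩ := ha
    obtain ⟨hlt', rfl, rfl⟩ := hb
    exfalso
    have H := h.prod_vec (l := 0) (by omega) (by omega) 1 1 1 1 1 1 1 1
      q₁ q₃ (q₄ + 1) (q₂ + 1)
      q₁ (q₄ + 1) q₂ (q₃ + 1)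
      (by omega) (by omega) (by refine ⟨?_, ?_, ?_, ?_⟩ <;> ring)
      (by refine ⟨?_, ?_, ?_, ?_⟩ <;> ring)
    have := key (e := q₁) (f := q₄ + 1) (x := q₂) (y := q₃) (by omega) (by omega) (by omega)
      (by omega) (by omega) (by omega) (by omega) (by omega)
      (by convert H using 1; ring)
    omega
  · obtain ⟨hlt, rfl, rfl⟩ := ha
    obtain ⟨hlt', rfl, rfl⟩ := hb
    exfalso
    have H := h.prod_vec (l := q₄) (by omega) (by omega) 0 0 0 1 0 1 0 0
      (q₁ - q₄ + p - 1) (q₃ - q₄ + p) (q₂ - q₄ + p - 1 + 1) (q₄ - q₄)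
      (q₁ - q₄ + p - 1 + 1) (q₄ - q₄) (q₂ - q₄ + p - 1) (q₃ - q₄ + p)
      (by omega) (by omega) (by refine ⟨?_, ?_, ?_, ?_⟩ <;> ring)
      (by refine ⟨?_, ?_, ?_, ?_⟩ <;> ring)
    have := key (e := q₃ - q₄ + p) (f := q₄ - q₄) (x := q₂ - q₄ + p - 1) (y := q₁ - q₄ + p - 1)
      (by omega) (by omega) (by omega)
      (by omega) (by omega) (by omega) (by omega) (by omega)
      (by convert H using 1 <;> ring)
    omega
  · obtain ⟨rfl, rfl⟩ := ha
    obtain ⟨hlt', rfl, rfl⟩ := hb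
    rcases h₂₃.lt_or_eq with h' | h'
    · exfalso
      have H := h.prod_vec (l := q₃) (by omega) (by omega) 0 0 1 1 0 1 0 1
        (q₁ - q₃ + p - 1) (q₂ - q₃ + p) (q₄ - q₃ + 1) (q₃ - q₃)
        (q₁ - q₃ + p - 1 + 1) (q₄ - q₃) (q₂ - q₃ + p) (q₃ - q₃)
        (by omega) (by omega) (by refine ⟨?_, ?_, ?_, ?_⟩ <;> ring)
        (by refine ⟨?_, ?_, ?_, ?_⟩ <;> ring)
      have := key (e := q₂ - q₃ + p) (f := q₃ - q₃) (x := q₄ - q₃) (y := q₁ - q₃ + p - 1)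
        (by omega) (by omega) (by omega) (by omega) (by omega) (by omega) (by omega) (by omega)
        (by convert H using 1 <;> ring)
      omega
    rcases h₃₄.lt_or_eq with h'' | h''
    · exfalso
      have H := h.prod_vec (l := q₄) (by omega) (by omega) 0 0 1 0 0 1 0 0
        (q₁ - q₄ + p - 1) (q₂ - q₄ + p - 1 + 1) (q₄ - q₄) (q₃ - q₄ + p)
        (q₁ - q₄ + p - 1 + 1) (q₄ - q₄) (q₂ - q₄ + p - 1) (q₃ - q₄ + p)
        (by omega) (by omega) (by refine ⟨?_, ?_, ?_, ?_⟩ <;> ring)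
        (by refine ⟨?_, ?_, ?_, ?_⟩ <;> ring)
      have := key (e := q₄ - q₄) (f := q₃ - q₄ + p) (x := q₂ - q₄ + p - 1) (y := q₁ - q₄ + p - 1)
        (by omega) (by omega) (by omega) (by omega) (by omega) (by omega) (by omega) (by omega)
        (by convert H using 1 <;> ring)
      omega
    subst h' h''
    refine ⟨by omega, 0, 0, 1, by omega, -1, by omega, ?_⟩
    simp only [digitValue, add_zero, Matrix.cons_val]
    ring
  · obtain ⟨hlt, rfl, rfl⟩ := ha
    obtain ⟨rfl, rfl⟩ := hb
    simp only [Fin.sum_univ_four, Matrix.cons_val] at hsum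
    omega
  · obtain ⟨hlt, rfl, rfl⟩ := ha
    obtain ⟨rfl, rfl⟩ := hb
    simp only [Fin.sum_univ_four, Matrix.cons_val] at hsum
    omega
  · obtain ⟨rfl, rfl⟩ := ha
    obtain ⟨rfl, rfl⟩ := hb
    simp only [Fin.sum_univ_four, Matrix.cons_val] at hsum
    omega
  · obtain ⟨hlt, rfl, rfl⟩ := ha
    obtain ⟨rfl, rfl⟩ := hb
    simp only [Fin.sum_univ_four, Matrix.cons_val] at hsum
    omega
  · obtain ⟨hlt, rfl, rfl⟩ := ha
    obtain ⟨rfl, rfl⟩ := hb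
    simp only [Fin.sum_univ_four, Matrix.cons_val] at hsum
    omega
  · obtain ⟨hlt, rfl, rfl⟩ := ha
    obtain ⟨rfl, rfl⟩ := hb
    simp only [Fin.sum_univ_four, Matrix.cons_val] at hsum
    omega
  · obtain ⟨rfl, rfl⟩ := ha
    obtain ⟨rfl, rfl⟩ := hb
    simp only [Fin.sum_univ_four, Matrix.cons_val] at hsum
    omega
  · obtain ⟨hlt, rfl, rfl⟩ := ha
    obtain ⟨rfl, rfl⟩ := hb
    simp only [Fin.sum_univ_four, Matrix.cons_val] at hsum
    omega
  · obtain ⟨rfl, rfl⟩ := ha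
    obtain ⟨rfl, rfl⟩ := hb
    simp only [Fin.sum_univ_four, Matrix.cons_val] at hsum
    omega

theorem HasOrderType.digits_eq {n : ℕ} {q₁ q₂ q₃ q₄ : ℤ} {a t b s : Fin 4 → ℤ}
    (ha : HasOrderType n q₁ q₂ q₃ q₄ a t) (hb : HasOrderType n q₁ q₂ q₃ q₄ b s) : a = b := by
  match n with
  | 0 => exact ha.2.2.trans hb.2.2.symm
  | 1 => exact ha.2.2.trans hb.2.2.symm
  | 2 => exact ha.2.trans hb.2.symm
  | 3 => exact ha.2.2.trans hb.2.2.symm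
  | 4 => exact ha.2.trans hb.2.symm
  | n + 5 => exact ha.2.trans hb.2.symm

theorem DigitOrbit.exists_rotate_min {p N : ℤ} {a X : Fin 4 → ℤ} (h : DigitOrbit p N a X) :
    ∃ r : Fin 4, ∀ i, i ≠ 0 → X (0 + r) < X (i + r) := by
  obtain ⟨r, hr⟩ := Finite.exists_min X
  refine ⟨r, fun i hi => lt_of_le_of_ne (by rw [zero_add]; exact hr _) ?_⟩
  rw [zero_add, add_comm i r]
  fin_cases i
  · exact absurd rfl hi
  · exact h.ne_succ r
  · exact h.ne_add_two r
  · have := h.ne_succ (r + 3)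
    rw [add_assoc] at this
    simpa using this.symm

/-- Two digit orbits with the same translation data have the same digits up to rotation, or are
related by an explicit exceptional congruence. -/
theorem DigitOrbit.eq_rotate_or_shiftClose {p : ℕ} (hp : p.Prime) {N : ℤ}
    {a X b Y : Fin 4 → ℤ} (hX : DigitOrbit p N a X) (hY : DigitOrbit p N b Y)
    (h : CutAgree p a (lowDigit a X) b (lowDigit b Y)) :
    (∃ r s : Fin 4, ∀ i, a (i + r) = b (i + s)) ∨ 3 ≤ p ∧ ShiftClose p a b := by
  obtain ⟨r, hr⟩ := hX.exists_rotate_min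
  obtain ⟨s, hs⟩ := hY.exists_rotate_min
  obtain ⟨m, hm, q₁, q₂, q₃, q₄, h1, h12, h23, h34, h4, ha⟩ := (hX.rotate r).exists_orderType hr
  obtain ⟨n, hn, z₁, z₂, z₃, z₄, g1, g12, g23, g34, g4, hb⟩ := (hY.rotate s).exists_orderType hs
  rw [DigitOrbit.lowDigit_rotate] at ha hb
  have H := h.rotate r s
  have hz : (0 : ℤ) < p := by have := hp.pos; omega
  have hp2 : (2 : ℤ) ≤ p := by have := hp.two_le; omega
  have hsum : ∑ i, a (i + r) = ∑ i, b (i + s) := by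
    have := H.sum_digits_eq le_rfl hz
    rw [ha.sum_comp fun x => if (0 : ℤ) ≤ x then 1 else 0,
      hb.sum_comp fun x => if (0 : ℤ) ≤ x then 1 else 0] at this
    simp only [show (0 : ℤ) ≤ q₁ by omega, show (0 : ℤ) ≤ q₂ by omega,
      show (0 : ℤ) ≤ q₃ by omega, show (0 : ℤ) ≤ q₄ by omega, show (0 : ℤ) ≤ z₁ by omega,
      show (0 : ℤ) ≤ z₂ by omega, show (0 : ℤ) ≤ z₃ by omega, show (0 : ℤ) ≤ z₄ by omega,
      if_true] at this
    linarith
  obtain ⟨rfl, rfl, rfl, rfl⟩ : q₁ = z₁ ∧ q₂ = z₂ ∧ q₃ = z₃ ∧ q₄ = z₄ := by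
    refine eq_of_sum_indicator_eq (m := p) h1 h12 h23 h34 (by omega) g1 g12 g23 g34 (by omega) ?_
    intro l h0 hl
    have := H.sum_digits_eq h0 hl
    rw [hsum, ha.sum_comp fun x => if l ≤ x then 1 else 0,
      hb.sum_comp fun x => if l ≤ x then 1 else 0] at this
    exact mul_left_cancel₀ (show (p : ℤ) - 1 ≠ 0 by omega) (by linarith)
  have back : ∀ {f g : Fin 4 → ℤ} {r s : Fin 4},
      ShiftClose p (fun i => f (i + r)) (fun i => g (i + s)) → ShiftClose p f g := by
    rintro f g r s ⟨r', s', c, hc, ε, hε, he⟩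
    exact ⟨r' + r, s' + s, c, hc, ε, hε, by simpa only [add_assoc] using he⟩
  rcases lt_trichotomy m n with hmn | rfl | hmn
  · have := ha.shiftClose hp hmn hn h1 h12 h23 h34 h4 hb H hsum
    exact Or.inr ⟨this.1, back this.2⟩
  · exact Or.inl ⟨r, s, fun i => congrFun (ha.digits_eq hb) i⟩
  · have := hb.shiftClose hp hmn hm h1 h12 h23 h34 h4 ha H.symm hsum.symm
    exact Or.inr ⟨this.1, (back this.2).symm⟩

/-- Cyclic digit expansions determine the number they expand. -/
theorem digitValue_eq_of_step {p : ℤ} (hp : 2 ≤ p) {c X : Fin 4 → ℤ}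
    (h : ∀ i, p * X i = c i * (p ^ 4 - 1) + X (i + 1)) : digitValue p c = X 0 := by
  have h0 : p * X 0 = c 0 * (p ^ 4 - 1) + X 1 := h 0
  have h1 : p * X 1 = c 1 * (p ^ 4 - 1) + X 2 := h 1
  have h2 : p * X 2 = c 2 * (p ^ 4 - 1) + X 3 := h 2
  have h3 : p * X 3 = c 3 * (p ^ 4 - 1) + X 0 := h 3
  have hQ : p ^ 4 - 1 ≠ 0 := by
    have : 2 ^ 4 ≤ p ^ 4 := pow_le_pow_left₀ (by norm_num) hp 4
    omega
  refine mul_right_cancel₀ hQ ?_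
  unfold digitValue
  linear_combination (-p ^ 3) * h0 - p ^ 2 * h1 - p * h2 - h3

theorem pow_modEq_pow_mod_four (p : ℤ) (e : ℕ) : p ^ e ≡ p ^ (e % 4) [ZMOD p ^ 4 - 1] := by
  conv_lhs => rw [← Nat.div_add_mod e 4, pow_add, pow_mul]
  have h : p ^ 4 ≡ 1 [ZMOD p ^ 4 - 1] := (Int.modEq_iff_dvd.mpr (by simp)).symm
  simpa using (h.pow (e / 4)).mul_right (p ^ (e % 4))

/-- The exponents of characters that do not factor through the norm to the subfield with `p ^ 2`
elements. -/
def IsRegularExponent (p n : ℤ) : Prop := ¬ p ^ 4 - 1 ∣ (p ^ 2 - 1) * n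

/-- The orbit of `n` under multiplication by `p` modulo `p ^ 4 - 1`. -/
def expOrbit (p n : ℤ) (i : Fin 4) : ℤ := p ^ (i : ℕ) * n % (p ^ 4 - 1)

theorem expOrbit_modEq (p n : ℤ) (i : Fin 4) :
    expOrbit p n i ≡ p ^ (i : ℕ) * n [ZMOD p ^ 4 - 1] := Int.mod_modEq _ _

theorem expOrbit_add_modEq (p n : ℤ) (i j : Fin 4) :
    expOrbit p n (i + j) ≡ p ^ (j : ℕ) * expOrbit p n i [ZMOD p ^ 4 - 1] := by
  refine (expOrbit_modEq p n (i + j)).trans ?_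
  rw [Fin.val_add]
  refine ((pow_modEq_pow_mod_four p (i + j)).symm.mul_right n).trans ?_
  rw [pow_add, mul_comm (p ^ _), mul_assoc]
  exact (expOrbit_modEq p n i).symm.mul_left _

theorem expOrbit_succ (p n : ℤ) (i : Fin 4) :
    expOrbit p n (i + 1) = p * expOrbit p n i % (p ^ 4 - 1) := by
  have h := expOrbit_add_modEq p n i 1
  have e : expOrbit p n (i + 1) % (p ^ 4 - 1) = expOrbit p n (i + 1) := Int.emod_emod _ _
  rw [← e]
  simpa [Int.ModEq] using h

theorem isCoprime_pow_sub_one (p : ℤ) (e : ℕ) : IsCoprime (p ^ 4 - 1) (p ^ e) :=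
  IsCoprime.pow_right ⟨-1, p ^ 3, by ring⟩

theorem IsRegularExponent.digitOrbit {p n : ℤ} (hp : 2 ≤ p) (hn : IsRegularExponent p n) :
    DigitOrbit p (p ^ 3 + p ^ 2 + p + 1) (fun i => p * expOrbit p n i / (p ^ 4 - 1))
      (expOrbit p n) := by
  have hQ : (p - 1) * (p ^ 3 + p ^ 2 + p + 1) = p ^ 4 - 1 := by ring
  have hQ0 : 0 < p ^ 4 - 1 := by
    have : 2 ^ 4 ≤ p ^ 4 := pow_le_pow_left₀ (by norm_num) hp 4
    omega
  have hadd : ∀ i j : Fin 4, expOrbit p n (i + j) = expOrbit p n i →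
      p ^ 4 - 1 ∣ (p ^ (j : ℕ) - 1) * n := by
    intro i j hij
    have h := (expOrbit_add_modEq p n i j).symm
    rw [hij] at h
    have h' := (((expOrbit_modEq p n i).symm.mul_left (p ^ (j : ℕ))).trans h).trans
      (expOrbit_modEq p n i)
    refine (isCoprime_pow_sub_one p i).dvd_of_dvd_mul_left ?_
    refine h'.symm.dvd.trans (dvd_of_eq ?_)
    ring
  refine ⟨hp, by positivity, ?_, ?_, ?_, ?_, ?_⟩
  · intro i
    rw [hQ, expOrbit_succ]
    exact (Int.ediv_mul_add_emod _ _).symm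
  · intro i
    refine lt_of_le_of_ne (Int.emod_nonneg _ hQ0.ne') fun h => hn ?_
    have h' := expOrbit_modEq p n i
    rw [← h] at h'
    refine Dvd.dvd.mul_left ((isCoprime_pow_sub_one p i).dvd_of_dvd_mul_left ?_) _
    simpa using h'.dvd
  · intro i
    rw [hQ]
    exact Int.emod_lt_of_pos _ hQ0
  · intro i h
    refine hn ?_
    have := hadd i 1 h.symm
    refine (this.mul_left (p + 1)).trans (dvd_of_eq ?_)
    rw [show ((1 : Fin 4) : ℕ) = 1 from rfl]
    ring
  · intro i h
    refine hn ?_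
    simpa using hadd i 2 h.symm

/-- All base `p` expansions of residues of `n` and `n'` modulo `p ^ 4 - 1` have equal digit sums
and digit factorial products that agree modulo `p`. -/
def DigitAgree (p : ℕ) (n n' : ℤ) : Prop :=
  ∀ c d : Fin 4 → ℤ, (∀ i, 0 ≤ c i ∧ c i < p) → (∀ i, 0 ≤ d i ∧ d i < p) →
    digitValue p c < p ^ 4 - 1 → digitValue p d < p ^ 4 - 1 →
    digitValue p c ≡ n [ZMOD p ^ 4 - 1] → digitValue p d ≡ n' [ZMOD p ^ 4 - 1] →
    ∑ i, c i = ∑ i, d i ∧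
      ∏ i, (c i).toNat.factorial ≡ ∏ i, (d i).toNat.factorial [MOD p]

theorem DigitOrbit.cut_expansion {p n l : ℤ} (hp : 2 ≤ p) (hn : IsRegularExponent p n)
    (h0 : 0 ≤ l) (hl : l < p) {u c : Fin 4 → ℤ}
    (hu : ∀ i, u i = 1 ∧ l ≤ lowDigit (fun i => p * expOrbit p n i / (p ^ 4 - 1)) (expOrbit p n) i ∨
      u i = 0 ∧ lowDigit (fun i => p * expOrbit p n i / (p ^ 4 - 1)) (expOrbit p n) i < l)
    (hc : ∀ i, c i = p * expOrbit p n i / (p ^ 4 - 1) - l + p * (1 - u i) - (1 - u (i + 1))) :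
    (∀ i, 0 ≤ c i ∧ c i < p) ∧ digitValue p c < p ^ 4 - 1 ∧
      digitValue p c ≡ n + (p - 1 - l) * (p ^ 3 + p ^ 2 + p + 1) [ZMOD p ^ 4 - 1] := by
  have hX := hn.digitOrbit hp
  set X := expOrbit p n with hXdef
  have hb := hX.lowDigit_bounds
  set a : Fin 4 → ℤ := fun i => p * X i / (p ^ 4 - 1) with ha
  set N : ℤ := p ^ 3 + p ^ 2 + p + 1 with hN
  have hQ : (p - 1) * N = p ^ 4 - 1 := by rw [hN]; ring
  have hlN : l * N ≤ (p - 1) * N := mul_le_mul_of_nonneg_right (by omega) hX.N_pos.le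
  have hlN0 : 0 ≤ l * N := mul_nonneg h0 hX.N_pos.le
  set Z : Fin 4 → ℤ := fun i => X i - l * N + (1 - u i) * (p ^ 4 - 1) with hZ
  have hstep : ∀ i, p * Z i = c i * (p ^ 4 - 1) + Z (i + 1) := by
    intro i
    have h1 := hX.step i
    have h2 := hc i
    simp only [hZ]
    rw [h2]
    rw [hQ] at h1
    linear_combination h1 - l * hQ
  have hbd : ∀ i, 0 < Z i ∧ Z i < p ^ 4 - 1 := by
    intro i
    have h1 := hX.pos i
    have h2 := hX.lt i
    obtain ⟨h3, h4⟩ := hb i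
    simp only [hZ]
    rcases hu i with ⟨hu, hut⟩ | ⟨hu, hut⟩
    · have := mul_le_mul_of_nonneg_right hut hX.N_pos.le
      rw [hu]
      constructor <;> linarith
    · have : (lowDigit a X i + 1) * N ≤ l * N :=
        mul_le_mul_of_nonneg_right (by omega) hX.N_pos.le
      rw [hu]
      constructor <;> linarith
  have hval := digitValue_eq_of_step hp hstep
  refine ⟨fun i => DigitOrbit.digit_bounds (hbd i).1 (hbd i).2 (hbd (i + 1)).1 (hbd (i + 1)).2 hp
    (hstep i), by rw [hval]; exact (hbd 0).2, ?_⟩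
  rw [hval]
  have h1 := expOrbit_modEq p n 0
  simp only [Fin.val_zero, pow_zero, one_mul] at h1
  have h2 : Z 0 ≡ X 0 + (p - 1 - l) * N [ZMOD p ^ 4 - 1] := by
    refine Int.modEq_iff_dvd.mpr ⟨u 0, ?_⟩
    simp only [hZ]
    linear_combination hQ
  exact h2.trans (h1.add_right _)

/-- Regular exponents whose translates by multiples of `(p ^ 4 - 1) / (p - 1)` all have matching
digits are conjugate, or satisfy one of finitely many exceptional congruences. -/
theorem conj_or_exceptional {p : ℕ} (hp : p.Prime) {n n' : ℤ} (hn : IsRegularExponent p n)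
    (hn' : IsRegularExponent p n')
    (h : ∀ m : ℕ, DigitAgree p (n + m * (p ^ 3 + p ^ 2 + p + 1))
      (n' + m * (p ^ 3 + p ^ 2 + p + 1))) :
    (∃ i : Fin 4, n ≡ p ^ (i : ℕ) * n' [ZMOD p ^ 4 - 1]) ∨
      3 ≤ p ∧ ∃ i c : Fin 4, ∃ ε : ℤ, (ε = 1 ∨ ε = -1) ∧
        n - p ^ (i : ℕ) * n' ≡ ε * ((p - 1) * p ^ (c : ℕ)) [ZMOD p ^ 4 - 1] := by
  have hp2 : (2 : ℤ) ≤ p := by have := hp.two_le; omega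
  have hX := hn.digitOrbit hp2
  have hY := hn'.digitOrbit hp2
  have hQ : ((p : ℤ) - 1) * (p ^ 3 + p ^ 2 + p + 1) = p ^ 4 - 1 := by ring
  have hcut := DigitOrbit.eq_rotate_or_shiftClose hp hX hY ?_
  · have hval : ∀ (n : ℤ) (hn : IsRegularExponent p n) (r : Fin 4),
        digitValue p (fun i => p * expOrbit p n (i + r) / (p ^ 4 - 1)) ≡ p ^ (r : ℕ) * n
          [ZMOD p ^ 4 - 1] := by
      intro n hn r
      have := digitValue_eq_of_step hp2 (c := fun i => p * expOrbit p n (i + r) / (p ^ 4 - 1))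
        (X := fun i => expOrbit p n (i + r)) (by
          have := ((hn.digitOrbit hp2).rotate r).step
          simpa only [hQ] using this)
      rw [this, zero_add]
      exact expOrbit_modEq _ _ _
    have hback : ∀ (r s : Fin 4) (e : ℤ), (p : ℤ) ^ (r : ℕ) * n - p ^ (s : ℕ) * n' ≡ e
        [ZMOD p ^ 4 - 1] → n - p ^ ((s - r : Fin 4) : ℕ) * n' ≡ p ^ ((-r : Fin 4) : ℕ) * e
        [ZMOD p ^ 4 - 1] := by
      intro r s e he
      refine Int.ModEq.trans ?_ (he.mul_left _)
      rw [mul_sub, ← mul_assoc, ← mul_assoc, ← pow_add, ← pow_add]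
      refine Int.ModEq.sub ?_ (Int.ModEq.mul_right _ ?_)
      · have h1 := pow_modEq_pow_mod_four p ((-r : Fin 4) + (r : ℕ))
        rw [← Fin.val_add, neg_add_cancel] at h1
        simpa using (h1.mul_right n).symm
      · rw [show s - r = -r + s from sub_eq_neg_add s r, Fin.val_add]
        exact (pow_modEq_pow_mod_four p _).symm
    rcases hcut with ⟨r, s, hrs⟩ | ⟨h3, r, s, c, hc, ε, hε, he⟩
    · refine Or.inl ⟨s - r, ?_⟩
      have h1 := hback r s 0 (by
        have h2 := (hval n hn r).symm
        rw [funext hrs] at h2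
        simpa using (h2.trans (hval n' hn' s)).sub_right (p ^ (s : ℕ) * n'))
      rw [mul_zero] at h1
      simpa using h1.add_right (p ^ ((s - r : Fin 4) : ℕ) * n')
    · refine Or.inr ⟨h3, s - r, -r + ⟨c, hc⟩, ε, hε, ?_⟩
      refine (hback r s _ ((((hval n hn r).sub (hval n' hn' s)).symm).trans
        (congrArg (· % ((p : ℤ) ^ 4 - 1)) he))).trans ?_
      rw [Fin.val_add]
      refine Int.ModEq.trans ?_ (((pow_modEq_pow_mod_four p _).mul_left _).mul_left _)
      refine congrArg (· % ((p : ℤ) ^ 4 - 1)) ?_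
      rw [pow_add]
      ring
  · intro l h0 hl u v c d hu hv hc hd
    obtain ⟨hc1, hc2, hc3⟩ := DigitOrbit.cut_expansion hp2 hn h0 hl hu hc
    obtain ⟨hd1, hd2, hd3⟩ := DigitOrbit.cut_expansion hp2 hn' h0 hl hv hd
    have hm : (((p : ℤ) - 1 - l).toNat : ℤ) = p - 1 - l := Int.toNat_of_nonneg (by omega)
    exact h (p - 1 - l : ℤ).toNat c d hc1 hd1 hc2 hd2 (by rwa [hm]) (by rwa [hm])

/-- A multiplicative character `θ` and an additive character `Ψ` of a field `E` with `p ^ 4`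
elements, such that `θ` is the inverse of a Teichmüller character with respect to the reduction
map `φ` and `Ψ` is nontrivial and invariant under Frobenius. -/
structure TeichmullerData (p : ℕ) {E R k : Type*} [Field E] [Fintype E] [CommRing R] [Field k]
    (φ : R →+* k) (ι : E →+* k) (θ : MulChar E R) (Ψ : AddChar E R) : Prop where
  prime : p.Prime
  card : Fintype.card E = p ^ 4
  charP : CharP k p
  map_char : ∀ x, φ (θ x) = ι x ^ (p ^ 4 - 2)
  map_addChar : ∀ x, φ (Ψ x) = 1
  addChar_ne_one : Ψ ≠ 1
  addChar_pow : ∀ x, Ψ (x ^ p) = Ψ x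

namespace TeichmullerData

variable {p : ℕ} {E R k : Type*} [Field E] [Fintype E] [CommRing R] [Field k]
  {φ : R →+* k} {ι : E →+* k} {θ : MulChar E R} {Ψ : AddChar E R}

theorem sixteen_le (h : TeichmullerData p φ ι θ Ψ) : 16 ≤ p ^ 4 :=
  Nat.pow_le_pow_left h.prime.two_le 4

theorem cast_card (h : TeichmullerData p φ ι θ Ψ) : ((p ^ 4 : ℕ) : E) = 0 := by
  rw [← h.card, FiniteField.cast_card_eq_zero]

theorem pow_card_sub_one (h : TeichmullerData p φ ι θ Ψ) {x : E} (hx : x ≠ 0) :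
    x ^ (p ^ 4 - 1) = 1 := by
  rw [← h.card]
  exact FiniteField.pow_card_sub_one_eq_one x hx

theorem map_char_pow (h : TeichmullerData p φ ι θ Ψ) {n : ℕ} (hn : n < p ^ 4 - 1) (x : E) :
    φ ((θ ^ n) x) = ι (x ^ (p ^ 4 - 1 - n)) := by
  by_cases hx : x = 0
  · subst hx
    rw [MulChar.map_nonunit _ not_isUnit_zero, map_zero, zero_pow (by omega), map_zero]
  · have hu : IsUnit x := Ne.isUnit hx
    rw [← hu.unit_spec, MulChar.pow_apply_coe, map_pow, hu.unit_spec, h.map_char, ← map_pow,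
      ← map_pow]
    congr 1
    have h1 : x ^ n * x ^ (p ^ 4 - 1 - n) = 1 := by
      rw [← pow_add, Nat.add_sub_cancel' hn.le, h.pow_card_sub_one hx]
    have h2 : x ^ n * (x ^ (p ^ 4 - 2)) ^ n = 1 := by
      rw [← mul_pow, ← pow_succ', show p ^ 4 - 2 + 1 = p ^ 4 - 1 by omega, h.pow_card_sub_one hx,
        one_pow]
    exact mul_left_cancel₀ (pow_ne_zero n hx) (h2.trans h1.symm)

theorem sum_pow_mul_pow (h : TeichmullerData p φ ι θ Ψ) {m : ℕ} (hm : m ≤ p ^ 4 - 1) :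
    ∑ x : E, x ^ m * (1 - x) ^ (p ^ 4 - 2) = (m : E) := by
  have hq := h.sixteen_le
  have key : ∀ x : E, x ^ m * (1 - x) ^ (p ^ 4 - 2) =
      (1 - x) ^ (p ^ 4 - 2) - ∑ i ∈ Finset.range m, (x ^ i - if x = 1 then 1 else 0) := by
    intro x
    by_cases hx : x = 1
    · subst hx
      simp [zero_pow (show p ^ 4 - 2 ≠ 0 by omega)]
    · have h1 : (1 - x) * (1 - x) ^ (p ^ 4 - 2) = 1 := by
        rw [← pow_succ', show p ^ 4 - 2 + 1 = p ^ 4 - 1 by omega,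
          h.pow_card_sub_one (sub_ne_zero.mpr (Ne.symm hx))]
      have h2 := mul_neg_geom_sum x m
      simp only [hx, if_false, sub_zero]
      linear_combination ((1 - x) ^ (p ^ 4 - 2)) * h2 - (∑ i ∈ Finset.range m, x ^ i) * h1
  rw [Finset.sum_congr rfl fun x _ => key x, Finset.sum_sub_distrib, Finset.sum_comm]
  have h3 : ∑ x : E, (1 - x) ^ (p ^ 4 - 2) = 0 := by
    refine ((Equiv.subLeft (1 : E)).sum_comp fun y => y ^ (p ^ 4 - 2)).trans ?_
    exact FiniteField.sum_pow_lt_card_sub_one E _ (by rw [h.card]; omega)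
  have h4 : ∀ i ∈ Finset.range m, ∑ x : E, (x ^ i - if x = 1 then 1 else 0) = -1 := by
    intro i hi
    rw [Finset.sum_sub_distrib, FiniteField.sum_pow_lt_card_sub_one E i
      (by rw [h.card]; have := Finset.mem_range.mp hi; omega)]
    simp
  rw [h3, Finset.sum_congr rfl h4]
  simp

theorem map_jacobiSum (h : TeichmullerData p φ ι θ Ψ) {n : ℕ} (hn : n < p ^ 4 - 1) :
    φ (jacobiSum (θ ^ n) θ) = -((n : k) + 1) := by
  have hq := h.sixteen_le
  rw [jacobiSum, map_sum]
  simp only [map_mul, h.map_char_pow hn, h.map_char, ← map_pow]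
  simp only [← map_mul, ← map_sum]
  rw [h.sum_pow_mul_pow (Nat.sub_le _ _)]
  have h1 : ((p ^ 4 - 1 - n : ℕ) : E) = -((n : E) + 1) := by
    have h2 : ((p ^ 4 - 1 - n + (n + 1) : ℕ) : E) = 0 := by
      rw [show p ^ 4 - 1 - n + (n + 1) = p ^ 4 by omega, h.cast_card]
    push_cast at h2 ⊢
    linear_combination h2
  rw [h1]
  simp

theorem char_pow_eq_one (h : TeichmullerData p φ ι θ Ψ) : θ ^ (p ^ 4 - 1) = 1 := by
  rw [← h.card, ← Fintype.card_units]
  exact MulChar.pow_card_eq_one θ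

theorem char_pow_ne_one (h : TeichmullerData p φ ι θ Ψ) {n : ℕ} (h0 : n ≠ 0)
    (hn : n < p ^ 4 - 1) : θ ^ n ≠ 1 := by
  intro he
  obtain ⟨g, hg⟩ := IsCyclic.exists_generator (α := Eˣ)
  have h1 := h.map_char_pow hn g
  rw [he, MulChar.one_apply_coe, map_one, eq_comm, map_eq_one_iff ι ι.injective,
    ← Units.val_pow_eq_pow_val, Units.val_eq_one, ← orderOf_dvd_iff_pow_eq_one,
    orderOf_eq_card_of_forall_mem_zpowers hg, Nat.card_eq_fintype_card, Fintype.card_units,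
    h.card] at h1
  have := Nat.le_of_dvd (by omega) h1
  omega

/-- The Gauss sum of the `n`-th power of the Teichmüller character. -/
noncomputable def gauss (θ : MulChar E R) (Ψ : AddChar E R) (n : ℕ) : R := gaussSum (θ ^ n) Ψ

theorem gauss_mod (h : TeichmullerData p φ ι θ Ψ) {m n : ℕ} (hmn : m ≡ n [MOD p ^ 4 - 1]) :
    gauss θ Ψ m = gauss θ Ψ n := by
  unfold gauss
  rw [pow_eq_pow_of_modEq hmn h.char_pow_eq_one]

theorem gauss_mul (h : TeichmullerData p φ ι θ Ψ) (n : ℕ) :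
    gauss θ Ψ (p * n) = gauss θ Ψ n := by
  have : Fact p.Prime := ⟨h.prime⟩
  have hE : CharP E p := charP_of_card_eq_prime_pow (f := 4) h.card
  unfold gauss gaussSum
  rw [← (frobeniusEquiv E p).toEquiv.sum_comp fun x => (θ ^ n) x * Ψ x]
  refine Finset.sum_congr rfl fun x _ => ?_
  simp only [RingEquiv.toEquiv_eq_coe, EquivLike.coe_coe, frobeniusEquiv_apply, frobenius_def,
    h.addChar_pow, map_pow]
  congr 1
  rw [mul_comm, pow_mul]
  exact MulChar.pow_apply' _ h.prime.ne_zero x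

theorem map_gauss_one (h : TeichmullerData p φ ι θ Ψ) : φ (gauss θ Ψ 1) = 0 := by
  have hq := h.sixteen_le
  unfold gauss gaussSum
  simp only [pow_one, map_sum, map_mul, h.map_char, h.map_addChar, mul_one, ← map_pow]
  rw [← map_sum, FiniteField.sum_pow_lt_card_sub_one E _ (by rw [h.card]; omega), map_zero]

/-- Stickelberger's congruence for the Gauss sum of the power of the Teichmüller character whose
exponent has base `p` digits `a, b, c, d`. -/
def StickelbergerAt (p : ℕ) (φ : R →+* k) (θ : MulChar E R) (Ψ : AddChar E R)
    (a b c d : ℕ) : Prop :=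
  ∃ J : R, gauss θ Ψ (a * p ^ 3 + b * p ^ 2 + c * p + d) * J =
      gauss θ Ψ 1 ^ (a + b + c + d) ∧
    φ J = (-1) ^ (a + b + c + d + 1) *
      (a.factorial * b.factorial * c.factorial * d.factorial : ℕ)

theorem stickelbergerAt_rotate (h : TeichmullerData p φ ι θ Ψ) {a b c d : ℕ}
    (H : StickelbergerAt p φ θ Ψ a b c d) : StickelbergerAt p φ θ Ψ b c d a := by
  have hq := h.sixteen_le
  obtain ⟨J, h1, h2⟩ := H
  refine ⟨J, ?_, ?_⟩
  · rw [show b + c + d + a = a + b + c + d by ring, ← h1,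
      ← h.gauss_mul (a * p ^ 3 + b * p ^ 2 + c * p + d)]
    congr 1
    refine h.gauss_mod ?_
    have h3 : p ^ 4 ≡ 1 [MOD p ^ 4 - 1] := by
      conv_lhs => rw [← Nat.sub_add_cancel (show 1 ≤ p ^ 4 by omega)]
      simp [Nat.ModEq]
    have h4 := (h3.mul_left a).add_left (b * p ^ 3 + c * p ^ 2 + d * p)
    convert h4.symm using 1 <;> ring
  · rw [h2, show b + c + d + a = a + b + c + d by ring]
    congr 2
    ring

variable [IsDomain R]

theorem gauss_zero (h : TeichmullerData p φ ι θ Ψ) : gauss θ Ψ 0 = -1 := by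
  unfold gauss
  rw [pow_zero, gaussSum_one_left h.addChar_ne_one]

theorem gauss_one_ne_zero (h : TeichmullerData p φ ι θ Ψ) [CharZero R] : gauss θ Ψ 1 ≠ 0 := by
  have hq := h.sixteen_le
  unfold gauss
  refine gaussSum_ne_zero_of_nontrivial ?_ (h.char_pow_ne_one one_ne_zero (by omega))
    (AddChar.IsPrimitive.of_ne_one h.addChar_ne_one)
  rw [h.card]
  exact_mod_cast (show p ^ 4 ≠ 0 by omega)

theorem gauss_succ_mul (h : TeichmullerData p φ ι θ Ψ) {n : ℕ} (hn : n + 1 < p ^ 4 - 1) :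
    gauss θ Ψ (n + 1) * jacobiSum (θ ^ n) θ = gauss θ Ψ n * gauss θ Ψ 1 := by
  unfold gauss
  have := h.char_pow_ne_one n.succ_ne_zero hn
  rw [pow_succ] at this
  rw [pow_succ, pow_one]
  exact jacobiSum_mul_nontrivial this Ψ

theorem stickelbergerAt_zero (h : TeichmullerData p φ ι θ Ψ) :
    StickelbergerAt p φ θ Ψ 0 0 0 0 := by
  refine ⟨-1, ?_, ?_⟩
  · simp [h.gauss_zero]
  · simp

theorem stickelbergerAt_succ (h : TeichmullerData p φ ι θ Ψ) {a b c d : ℕ}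
    (hlt : a * p ^ 3 + b * p ^ 2 + c * p + (d + 1) < p ^ 4 - 1)
    (H : StickelbergerAt p φ θ Ψ a b c d) : StickelbergerAt p φ θ Ψ a b c (d + 1) := by
  have := h.charP
  obtain ⟨J, h1, h2⟩ := H
  have h3 : gauss θ Ψ (a * p ^ 3 + b * p ^ 2 + c * p + (d + 1)) *
      jacobiSum (θ ^ (a * p ^ 3 + b * p ^ 2 + c * p + d)) θ = _ := h.gauss_succ_mul hlt
  refine ⟨jacobiSum (θ ^ (a * p ^ 3 + b * p ^ 2 + c * p + d)) θ * J, ?_, ?_⟩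
  · linear_combination J * h3 + gauss θ Ψ 1 * h1
  · rw [map_mul, h2, h.map_jacobiSum (by omega), Nat.factorial_succ]
    push_cast
    rw [CharP.cast_eq_zero k p]
    ring

theorem stickelbergerAt_add (h : TeichmullerData p φ ι θ Ψ) {a b c : ℕ}
    (H : StickelbergerAt p φ θ Ψ a b c 0) (d : ℕ)
    (hlt : a * p ^ 3 + b * p ^ 2 + c * p + d < p ^ 4 - 1) :
    StickelbergerAt p φ θ Ψ a b c d := by
  induction d with
  | zero => exact H
  | succ d ih => exact h.stickelbergerAt_succ hlt (ih (by omega))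

theorem stickelbergerAt (h : TeichmullerData p φ ι θ Ψ) {a b c d : ℕ} (ha : a < p) (hb : b < p)
    (hc : c < p) (hlt : a * p ^ 3 + b * p ^ 2 + c * p + d < p ^ 4 - 1) :
    StickelbergerAt p φ θ Ψ a b c d := by
  have hp := h.prime.two_le
  have hab : a * p + b + 1 ≤ p ^ 2 := by nlinarith
  have habc : a * p ^ 2 + b * p + c + 1 ≤ p ^ 3 := by nlinarith
  have h2 : p * 2 ≤ p ^ 2 := by nlinarith
  have h3 : p ^ 2 * 2 ≤ p ^ 3 := by nlinarith [sq_nonneg p]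
  have h4 : p ^ 3 * 2 ≤ p ^ 4 := by nlinarith [pow_pos h.prime.pos 3]
  have H1 := h.stickelbergerAt_rotate (h.stickelbergerAt_add h.stickelbergerAt_zero a (by omega))
  have H2 := h.stickelbergerAt_rotate (h.stickelbergerAt_add H1 b (by omega))
  have H3 := h.stickelbergerAt_rotate (h.stickelbergerAt_add H2 c (by omega))
  exact h.stickelbergerAt_add H3 d hlt

theorem digits_of_gauss_eq [CharZero R] (h : TeichmullerData p φ ι θ Ψ) {a b c d a' b' c' d' : ℕ}
    (ha : a < p) (hb : b < p) (hc : c < p) (hd : d < p)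
    (ha' : a' < p) (hb' : b' < p) (hc' : c' < p) (hd' : d' < p)
    (H : StickelbergerAt p φ θ Ψ a b c d) (H' : StickelbergerAt p φ θ Ψ a' b' c' d')
    (he : gauss θ Ψ (a * p ^ 3 + b * p ^ 2 + c * p + d) =
      gauss θ Ψ (a' * p ^ 3 + b' * p ^ 2 + c' * p + d')) :
    a + b + c + d = a' + b' + c' + d' ∧
      a.factorial * b.factorial * c.factorial * d.factorial ≡
        a'.factorial * b'.factorial * c'.factorial * d'.factorial [MOD p] := by
  have := h.charP
  have hfac : ∀ n < p, ((n.factorial : ℕ) : k) ≠ 0 := by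
    intro n hn
    rw [Ne, CharP.cast_eq_zero_iff k p, h.prime.dvd_factorial]
    omega
  obtain ⟨J, h1, h2⟩ := H
  obtain ⟨J', h1', h2'⟩ := H'
  have hJ : φ J ≠ 0 := by
    rw [h2]
    push_cast
    exact mul_ne_zero (pow_ne_zero _ (by simp)) (mul_ne_zero (mul_ne_zero (mul_ne_zero
      (hfac a ha) (hfac b hb)) (hfac c hc)) (hfac d hd))
  have hJ' : φ J' ≠ 0 := by
    rw [h2']
    push_cast
    exact mul_ne_zero (pow_ne_zero _ (by simp)) (mul_ne_zero (mul_ne_zero (mul_ne_zero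
      (hfac a' ha') (hfac b' hb')) (hfac c' hc')) (hfac d' hd'))
  have hg1 := h.gauss_one_ne_zero
  have hg : gauss θ Ψ (a * p ^ 3 + b * p ^ 2 + c * p + d) ≠ 0 := by
    intro h0
    rw [h0, zero_mul] at h1
    exact pow_ne_zero _ hg1 h1.symm
  rw [← he] at h1'
  have hlt : ∀ {s t : ℕ} {J J' : R} {g : R}, g ≠ 0 → g * J = gauss θ Ψ 1 ^ s →
      g * J' = gauss θ Ψ 1 ^ t → φ J' ≠ 0 → t ≤ s := by
    intro s t J J' g hg h1 h1' hJ'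
    by_contra! hst
    obtain ⟨e, rfl⟩ := Nat.exists_eq_add_of_lt hst
    have : J' = J * gauss θ Ψ 1 ^ e * gauss θ Ψ 1 := by
      refine mul_left_cancel₀ hg ?_
      rw [h1', pow_succ, pow_add, ← h1]
      ring
    rw [this, map_mul, h.map_gauss_one, mul_zero] at hJ'
    exact hJ' rfl
  have hs := le_antisymm (hlt hg h1' h1 hJ) (hlt hg h1 h1' hJ')
  refine ⟨hs, ?_⟩
  have hJJ : J = J' := mul_left_cancel₀ hg (by rw [h1, h1', hs])
  rw [← hJJ, h2, hs] at h2'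
  have := mul_left_cancel₀ (pow_ne_zero _ (by simp)) h2'
  exact (CharP.natCast_eq_natCast k p).mp this

theorem digitAgree_of_gauss_eq [CharZero R] (h : TeichmullerData p φ ι θ Ψ) {n n' : ℕ}
    (he : gauss θ Ψ n = gauss θ Ψ n') : DigitAgree p n n' := by
  have hq := h.sixteen_le
  intro c d hc hd hcQ hdQ hcn hdn
  lift c to Fin 4 → ℕ using fun i => (hc i).1
  lift d to Fin 4 → ℕ using fun i => (hd i).1
  simp only [Nat.cast_nonneg, true_and, Nat.cast_lt] at hc hd
  have hcast : ((p ^ 4 - 1 : ℕ) : ℤ) = (p : ℤ) ^ 4 - 1 := by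
    push_cast [show 1 ≤ p ^ 4 by omega]
    rfl
  have key : ∀ {c : Fin 4 → ℕ} {n : ℕ}, digitValue p (fun i => (c i : ℤ)) < p ^ 4 - 1 →
      digitValue p (fun i => (c i : ℤ)) ≡ n [ZMOD p ^ 4 - 1] →
      c 0 * p ^ 3 + c 1 * p ^ 2 + c 2 * p + c 3 < p ^ 4 - 1 ∧
        c 0 * p ^ 3 + c 1 * p ^ 2 + c 2 * p + c 3 ≡ n [MOD p ^ 4 - 1] := by
    intro c n h1 h2
    have h3 : digitValue p (fun i => (c i : ℤ)) =
        ((c 0 * p ^ 3 + c 1 * p ^ 2 + c 2 * p + c 3 : ℕ) : ℤ) := by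
      simp [digitValue]
    rw [h3, ← hcast] at h1 h2
    exact ⟨by exact_mod_cast h1, Int.natCast_modEq_iff.mp h2⟩
  obtain ⟨c1, c2⟩ := key hcQ hcn
  obtain ⟨d1, d2⟩ := key hdQ hdn
  have H := h.digits_of_gauss_eq (hc 0) (hc 1) (hc 2) (hc 3) (hd 0) (hd 1) (hd 2) (hd 3)
    (h.stickelbergerAt (hc 0) (hc 1) (hc 2) c1) (h.stickelbergerAt (hd 0) (hd 1) (hd 2) d1)
    (by rw [h.gauss_mod c2, h.gauss_mod d2, he])
  simp only [Fin.sum_univ_four, Fin.prod_univ_four, Int.toNat_natCast]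
  exact ⟨by exact_mod_cast H.1, H.2⟩

end TeichmullerData

/-- The algebraic integers in `ℂ`. -/
abbrev AlgInt : Type := integralClosure ℤ ℂ

theorem exists_reduction (p : ℕ) [Fact p.Prime] (E : Type) [Field E] [Fintype E]
    [Algebra (ZMod p) E] :
    ∃ (k : Type) (_ : Field k) (_ : CharP k p) (_ : AlgInt →+* k), Nonempty (E →+* k) := by
  have hp : p.Prime := Fact.out
  have hmax : (Ideal.span {(p : ℤ)}).IsMaximal :=
    PrincipalIdealRing.isMaximal_of_irreducible (Nat.prime_iff_prime_int.mp hp).irreducible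
  obtain ⟨m, hm, hmp⟩ := Ideal.exists_ideal_over_maximal_of_isIntegral (S := AlgInt)
    (Ideal.span {(p : ℤ)}) (by
      rw [(RingHom.injective_iff_ker_eq_bot _).mp (FaithfulSMul.algebraMap_injective ℤ AlgInt)]
      exact bot_le)
  let F := AlgInt ⧸ m
  let : Field F := Ideal.Quotient.field m
  have hpF : ((p : ℕ) : F) = 0 := by
    have h1 : ((p : ℕ) : AlgInt) ∈ m := by
      have : (p : ℤ) ∈ m.comap (algebraMap ℤ AlgInt) := by
        rw [hmp]
        exact Ideal.mem_span_singleton_self _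
      simpa using this
    have := Ideal.Quotient.eq_zero_iff_mem.mpr h1
    simpa using this
  let k := AlgebraicClosure F
  have hpk : CharP k p := (CharP.charP_iff_prime_eq_zero hp).mpr (by
    rw [← map_natCast (algebraMap F k), hpF, map_zero])
  let : Algebra (ZMod p) k := ZMod.algebra k p
  refine ⟨k, inferInstance, hpk, (algebraMap F k).comp (Ideal.Quotient.mk m), ?_⟩
  exact ⟨(IsAlgClosed.lift (R := ZMod p) (S := E) (M := k) : E →ₐ[ZMod p] k).toRingHom⟩

theorem exists_teichmuller_char {p : ℕ} (hp : p.Prime) {E k : Type} [Field E] [Fintype E]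
    [Field k] [CharP k p] (hE : Fintype.card E = p ^ 4) (φ : AlgInt →+* k) (ι : E →+* k) :
    ∃ θ : MulChar E AlgInt, ∀ x, φ (θ x) = ι x ^ (p ^ 4 - 2) := by
  have hq : 16 ≤ p ^ 4 := Nat.pow_le_pow_left hp.two_le 4
  set Q := p ^ 4 - 1 with hQ
  have hQ0 : Q ≠ 0 := by omega
  have hcard : Fintype.card Eˣ = Q := by rw [Fintype.card_units, hE]
  obtain ⟨γ, hγ⟩ := IsCyclic.exists_generator (α := Eˣ)
  have hγo : orderOf γ = Q := by
    rw [orderOf_eq_card_of_forall_mem_zpowers hγ, Nat.card_eq_fintype_card, hcard]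
  have hιγ : IsPrimitiveRoot (ι γ) Q := by
    have h1 : IsPrimitiveRoot (γ : E) Q := by
      rw [IsPrimitiveRoot.coe_units_iff, ← hγo]
      exact IsPrimitiveRoot.orderOf γ
    exact h1.map_of_injective ι.injective
  have hζC : IsPrimitiveRoot (Complex.exp (2 * Real.pi * Complex.I / Q)) Q :=
    Complex.isPrimitiveRoot_exp Q hQ0
  let ζ : AlgInt := ⟨_, hζC.isIntegral (Nat.pos_of_ne_zero hQ0)⟩
  have hζ : IsPrimitiveRoot ζ Q :=
    IsPrimitiveRoot.of_map_of_injective (f := algebraMap AlgInt ℂ) hζC Subtype.val_injective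
  have hQk : ((Q : ℕ) : k) ≠ 0 := by
    rw [hQ, Nat.cast_sub (by omega)]
    push_cast
    rw [CharP.cast_eq_zero k p]
    simp
  have : NeZero ((Q : ℕ) : k) := ⟨hQk⟩
  have : NeZero Q := ⟨hQ0⟩
  have hφζ : IsPrimitiveRoot (φ ζ) Q := by
    rw [← Polynomial.isRoot_cyclotomic_iff, ← Polynomial.map_cyclotomic Q φ]
    exact (hζ.isRoot_cyclotomic (Nat.pos_of_ne_zero hQ0)).map
  obtain ⟨i, -, hi⟩ := hφζ.eq_pow_of_pow_eq_one
    (ξ := ι γ ^ (p ^ 4 - 2)) (by rw [← pow_mul, mul_comm, pow_mul, hιγ.pow_eq_one, one_pow])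
  obtain ⟨u, hu⟩ := hζ.isUnit hQ0
  have huQ : u ^ i ∈ rootsOfUnity (Fintype.card Eˣ) AlgInt := by
    rw [mem_rootsOfUnity, hcard, ← pow_mul, mul_comm, pow_mul]
    have : u ^ Q = 1 := Units.ext (by rw [Units.val_pow_eq_pow_val, hu, hζ.pow_eq_one]; rfl)
    rw [this, one_pow]
  refine ⟨MulChar.ofRootOfUnity huQ hγ, fun x => ?_⟩
  by_cases hx : x = 0
  · subst hx
    rw [MulChar.map_nonunit _ not_isUnit_zero, map_zero, map_zero, zero_pow (by omega)]
  · obtain ⟨y, rfl⟩ : IsUnit x := Ne.isUnit hx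
    obtain ⟨n, rfl⟩ := (mem_powers_iff_mem_zpowers.mpr (hγ y))
    simp only [Units.val_pow_eq_pow_val, map_pow, MulChar.ofRootOfUnity_spec, hu, hi]
    rw [← pow_mul, ← pow_mul, mul_comm]

theorem exists_integral_addChar {p : ℕ} [Fact p.Prime] (ψ : AddChar (ZMod p) ℂ) :
    ∃ ψ' : AddChar (ZMod p) AlgInt, ∀ x, (ψ' x : ℂ) = ψ x := by
  have hmem : ∀ x, ψ x ∈ integralClosure ℤ ℂ := by
    intro x
    refine IsIntegral.of_pow (n := p) (Fact.out : p.Prime).pos ?_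
    rw [← AddChar.map_nsmul_eq_pow]
    simp [isIntegral_one]
  exact ⟨{ toFun := fun x => ⟨ψ x, hmem x⟩
           map_zero_eq_one' := Subtype.ext (AddChar.map_zero_eq_one ψ)
           map_add_eq_mul' := fun x y => Subtype.ext (AddChar.map_add_eq_mul ψ x y) },
    fun x => rfl⟩

theorem exists_teichmullerData {p : ℕ} [Fact p.Prime] {E : Type} [Field E] [Fintype E]
    [Algebra (ZMod p) E] (hE : Fintype.card E = p ^ 4) {ψ : AddChar (ZMod p) ℂ} (hψ : ψ ≠ 1) :
    ∃ (k : Type) (_ : Field k) (φ : AlgInt →+* k) (ι : E →+* k) (θ : MulChar E AlgInt)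
      (Ψ : AddChar E AlgInt), TeichmullerData p φ ι θ Ψ ∧
        ∀ x, (Ψ x : ℂ) = ψ (Algebra.trace (ZMod p) E x) := by
  have hp : p.Prime := Fact.out
  obtain ⟨k, _, hk, φ, ⟨ι⟩⟩ := exists_reduction p E
  obtain ⟨θ, hθ⟩ := exists_teichmuller_char hp hE φ ι
  obtain ⟨ψ', hψ'⟩ := exists_integral_addChar ψ
  have hchar : CharP E p := charP_of_injective_algebraMap (algebraMap (ZMod p) E).injective p
  refine ⟨k, _, φ, ι, θ, ψ'.compAddMonoidHom (Algebra.trace (ZMod p) E).toAddMonoidHom,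
    ⟨hp, hE, hk, hθ, ?_, ?_, ?_⟩, fun x => hψ' _⟩
  · intro x
    have h1 : φ (ψ' (Algebra.trace (ZMod p) E x)) ^ p = 1 := by
      rw [← map_pow, ← AddChar.map_nsmul_eq_pow]
      simp
    have : ExpChar k p := ExpChar.prime hp
    exact frobenius_inj k p (by simpa [frobenius_def] using h1)
  · obtain ⟨y, hy⟩ := AddChar.ne_one_iff.mp hψ
    obtain ⟨x, rfl⟩ := Algebra.trace_surjective (ZMod p) E y
    refine AddChar.ne_one_iff.mpr ⟨x, fun h => hy ?_⟩
    rw [← hψ']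
    exact congrArg Subtype.val h
  · intro x
    have h1 := Algebra.trace_eq_of_algEquiv (FiniteField.frobeniusAlgEquivOfAlgebraic (ZMod p) E) x
    rw [FiniteField.coe_frobeniusAlgEquivOfAlgebraic, ZMod.card] at h1
    exact congrArg ψ' h1

theorem TeichmullerData.exists_isPrimitiveRoot {p : ℕ} {E R k : Type*} [Field E] [Fintype E]
    [CommRing R] [Field k] {φ : R →+* k} {ι : E →+* k} {θ : MulChar E R} {Ψ : AddChar E R}
    (h : TeichmullerData p φ ι θ Ψ) :
    ∃ γ : Eˣ, (∀ x, x ∈ Submonoid.powers γ) ∧ IsPrimitiveRoot (θ γ) (p ^ 4 - 1) := by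
  have hq := h.sixteen_le
  obtain ⟨γ, hγ⟩ := IsCyclic.exists_generator (α := Eˣ)
  refine ⟨γ, fun x => mem_powers_iff_mem_zpowers.mpr (hγ x), ?_⟩
  refine IsPrimitiveRoot.mk_of_lt _ (by omega) ?_ fun l hl0 hl he => ?_
  · rw [← MulChar.pow_apply_coe, h.char_pow_eq_one, MulChar.one_apply_coe]
  · refine h.char_pow_ne_one hl0.ne' hl ((MulChar.eq_iff hγ _ _).mpr ?_)
    rw [MulChar.pow_apply_coe, he, MulChar.one_apply_coe]

theorem TeichmullerData.exists_exponent {p : ℕ} {E k : Type} [Field E] [Fintype E]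
    [Field k] {φ : AlgInt →+* k} {ι : E →+* k} {θ : MulChar E AlgInt} {Ψ : AddChar E AlgInt}
    (h : TeichmullerData p φ ι θ Ψ) (χ : Eˣ →* ℂˣ) :
    ∃ n : ℕ, ∀ x : Eˣ, (χ x : ℂ) = (θ x : ℂ) ^ n := by
  have hq := h.sixteen_le
  obtain ⟨γ, hγ, hz⟩ := h.exists_isPrimitiveRoot
  have : NeZero (p ^ 4 - 1) := ⟨by omega⟩
  have hzC : IsPrimitiveRoot (θ γ : ℂ) (p ^ 4 - 1) :=
    hz.map_of_injective (f := algebraMap AlgInt ℂ) Subtype.val_injective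
  have h1 : (χ γ : ℂ) ^ (p ^ 4 - 1) = 1 := by
    rw [← h.card, ← Fintype.card_units, ← Units.val_pow_eq_pow_val, ← map_pow, pow_card_eq_one,
      map_one, Units.val_one]
  obtain ⟨n, -, hn⟩ := hzC.eq_pow_of_pow_eq_one h1
  refine ⟨n, fun x => ?_⟩
  obtain ⟨i, rfl⟩ := hγ x
  simp only [map_pow, Units.val_pow_eq_pow_val, ← hn, SubmonoidClass.coe_pow]
  rw [← pow_mul, ← pow_mul, mul_comm]

namespace TeichmullerData

/-- The complex-valued character of the unit group attached to `θ`. -/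
noncomputable def unitsHom {E : Type} [Field E] (θ : MulChar E AlgInt) : Eˣ →* ℂˣ :=
  Units.map ((algebraMap AlgInt ℂ : AlgInt →* ℂ).comp θ.toMonoidHom)

theorem coe_unitsHom {E : Type} [Field E] {θ : MulChar E AlgInt} (x : Eˣ) :
    (unitsHom θ x : ℂ) = (θ x : ℂ) := rfl

variable {p : ℕ} {E k : Type} [Field E] [Fintype E] [Field k] {φ : AlgInt →+* k} {ι : E →+* k}
  {θ : MulChar E AlgInt} {Ψ : AddChar E AlgInt}

theorem gauss_eq_sum_units (n : ℕ) : gauss θ Ψ n = ∑ x : Eˣ, θ x ^ n * Ψ x := by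
  unfold gauss gaussSum
  refine (Fintype.sum_of_injective (fun x : Eˣ => (x : E)) Units.val_injective _ _ ?_ ?_).symm
  · intro x hx
    rw [MulChar.map_nonunit _ (fun hu => hx ⟨hu.unit, rfl⟩), zero_mul]
  · intro x
    simp only [MulChar.pow_apply_coe]

theorem twistedGaussSum_eq [Fact p.Prime] [Algebra (ZMod p) E] (h : TeichmullerData p φ ι θ Ψ)
    {ψ : AddChar (ZMod p) ℂ} (hΨ : ∀ x, (Ψ x : ℂ) = ψ (Algebra.trace (ZMod p) E x))
    {χ : Eˣ →* ℂˣ} {n : ℕ} (hχ : ∀ x : Eˣ, (χ x : ℂ) = (θ x : ℂ) ^ n) (m : ℕ) :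
    twistedGaussSum (ZMod p) χ
      (((unitsHom θ).comp (Units.map (algebraMap (ZMod p) E : ZMod p →* E))) ^ m) ψ =
      gauss θ Ψ (n + m * (p ^ 3 + p ^ 2 + p + 1)) := by
  have hdiv : (p ^ 4 - 1) / (p - 1) = p ^ 3 + p ^ 2 + p + 1 := by
    have hp := h.prime.two_le
    refine Nat.div_eq_of_eq_mul_left (by omega) ?_
    have h4 : 1 ≤ p ^ 4 := Nat.one_le_pow _ _ (by omega)
    zify [h4, h.prime.one_le]
    ring
  rw [gauss_eq_sum_units, twistedGaussSum]
  push_cast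
  refine Finset.sum_congr rfl fun x _ => ?_
  have hnorm : algebraMap (ZMod p) E (Algebra.norm (ZMod p) (x : E)) =
      x ^ (p ^ 3 + p ^ 2 + p + 1) := by
    rw [FiniteField.algebraMap_norm_eq_pow, Nat.card_eq_fintype_card, h.card, Nat.card_zmod, hdiv]
  rw [hχ, hΨ, MonoidHom.pow_apply, Units.val_pow_eq_pow_val, MonoidHom.comp_apply, coe_unitsHom,
    Units.coe_map, Units.coe_map, MonoidHom.coe_coe, hnorm, map_pow]
  push_cast
  ring

theorem isRegularExponent [Fact p.Prime] [Algebra (ZMod p) E] (h : TeichmullerData p φ ι θ Ψ)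
    {χ : Eˣ →* ℂˣ} {n : ℕ} (hχ : ∀ x : Eˣ, (χ x : ℂ) = (θ x : ℂ) ^ n) (hreg : IsRegularChar χ) :
    IsRegularExponent p n := by
  intro hdvd
  have hp := h.prime.two_le
  have hdiv : (p ^ 4 - 1) / (p ^ 2 - 1) = p ^ 2 + 1 := by
    have h2 : 4 ≤ p ^ 2 := Nat.pow_le_pow_left hp 2
    refine Nat.div_eq_of_eq_mul_left (by omega) ?_
    have h4 : 1 ≤ p ^ 4 := Nat.one_le_pow _ _ (by omega)
    zify [h4, show 1 ≤ p ^ 2 by omega]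
    ring
  obtain ⟨c, rfl⟩ : p ^ 2 + 1 ∣ n := by
    have h2 : (4 : ℤ) ≤ (p : ℤ) ^ 2 := by exact_mod_cast Nat.pow_le_pow_left hp 2
    rw [show (p : ℤ) ^ 4 - 1 = ((p : ℤ) ^ 2 - 1) * ((p : ℤ) ^ 2 + 1) by ring] at hdvd
    have := Int.dvd_of_mul_dvd_mul_left (by omega) hdvd
    exact_mod_cast this
  have hfin : Module.finrank (ZMod p) E = 4 := by
    have h1 := Module.card_eq_pow_finrank (K := ZMod p) (V := E)
    rw [h.card, ZMod.card] at h1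
    exact (Nat.pow_right_injective hp h1).symm
  obtain ⟨f⟩ := FiniteField.nonempty_algHom_of_finrank_dvd (F := ZMod p) (K := GaloisField p 2)
    (L := E) (by rw [GaloisField.finrank p two_ne_zero, hfin]; norm_num)
  let K : Subfield E := f.toRingHom.fieldRange
  have hK : Nat.card K = p ^ 2 := by
    rw [← GaloisField.card p 2 two_ne_zero]
    exact Nat.card_congr f.toRingHom.rangeRestrictFieldEquiv.symm.toEquiv
  refine hreg K ?_ ⟨((unitsHom θ).comp (Units.map (K.subtype : K →* E))) ^ c, fun x => ?_⟩
  · intro hT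
    have h1 : Nat.card K = Nat.card E := by
      rw [hT]
      exact Nat.card_congr Subfield.topEquiv.toEquiv
    rw [hK, Nat.card_eq_fintype_card, h.card] at h1
    exact absurd (Nat.pow_right_injective hp h1) (by norm_num)
  · have hnorm : K.subtype (Algebra.norm K (x : E)) = x ^ (p ^ 2 + 1) := by
      have := FiniteField.algebraMap_norm_eq_pow (K := K) (K' := E) (x := (x : E))
      rwa [Nat.card_eq_fintype_card, h.card, hK, hdiv] at this
    ext
    rw [hχ, MonoidHom.pow_apply, Units.val_pow_eq_pow_val, MonoidHom.comp_apply, coe_unitsHom,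
      Units.coe_map, Units.coe_map, MonoidHom.coe_coe, hnorm, map_pow]
    push_cast
    ring

theorem gauss_mul_coprime (h : TeichmullerData p φ ι θ Ψ) {j n n' : ℕ}
    (hj : j.Coprime (p * (p ^ 4 - 1))) (hj1 : j ≡ 1 [MOD p]) (he : gauss θ Ψ n = gauss θ Ψ n') :
    gauss θ Ψ (j * n) = gauss θ Ψ (j * n') := by
  have hq := h.sixteen_le
  have hp := h.prime
  have hpos : 0 < p * (p ^ 4 - 1) := Nat.mul_pos hp.pos (by omega)
  obtain ⟨ζ, hζ⟩ : ∃ ζ : AlgInt, IsPrimitiveRoot ζ (p * (p ^ 4 - 1)) := by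
    have hζC := Complex.isPrimitiveRoot_exp _ hpos.ne'
    exact ⟨⟨_, hζC.isIntegral hpos⟩,
      IsPrimitiveRoot.of_map_of_injective (f := algebraMap AlgInt ℂ) hζC Subtype.val_injective⟩
  have : NeZero p := ⟨hp.ne_zero⟩
  have : NeZero (p ^ 4 - 1) := ⟨by omega⟩
  have hζp : IsPrimitiveRoot (ζ ^ p) (p ^ 4 - 1) := hζ.pow hpos rfl
  have hζq : IsPrimitiveRoot (ζ ^ (p ^ 4 - 1)) p := hζ.pow hpos (mul_comm _ _)
  have hψp : ∀ x, Ψ x ^ p = 1 := by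
    intro x
    have hE : CharP E p := by
      have := h.charP
      exact (RingHom.charP_iff ι ι.injective p).mpr this
    rw [← AddChar.map_nsmul_eq_pow, nsmul_eq_mul, CharP.cast_eq_zero, zero_mul,
      AddChar.map_zero_eq_one]
  have hf : ∀ x : Eˣ, ∃ i, (ζ ^ p) ^ i = θ x := by
    intro x
    obtain ⟨i, -, hi⟩ := hζp.eq_pow_of_pow_eq_one (ξ := θ x) (by
      rw [← MulChar.pow_apply_coe, h.char_pow_eq_one, MulChar.one_apply_coe])
    exact ⟨i, hi⟩
  have hg : ∀ x : Eˣ, ∃ i, (ζ ^ (p ^ 4 - 1)) ^ i = Ψ x := by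
    intro x
    obtain ⟨i, -, hi⟩ := hζq.eq_pow_of_pow_eq_one (hψp x)
    exact ⟨i, hi⟩
  choose f hf using hf
  choose g hg using hg
  let P : ℕ → Polynomial ℤ := fun n =>
    ∑ x : Eˣ, Polynomial.X ^ (p * f x * n + (p ^ 4 - 1) * g x)
  have hP : ∀ n, Polynomial.aeval ζ (P n) = gauss θ Ψ n := by
    intro n
    simp only [P, map_sum, map_pow, Polynomial.aeval_X, gauss_eq_sum_units, ← hf, ← hg]
    simp only [pow_add, pow_mul]
  have hPj : ∀ n, Polynomial.aeval (ζ ^ j) (P n) = gauss θ Ψ (j * n) := by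
    intro n
    simp only [P, map_sum, map_pow, Polynomial.aeval_X, gauss_eq_sum_units]
    refine Finset.sum_congr rfl fun x _ => ?_
    have h1 : Ψ x ^ j = Ψ x := by
      conv_rhs => rw [← pow_one (Ψ x)]
      exact pow_eq_pow_of_modEq hj1 (hψp x)
    rw [← h1, ← hf, ← hg]
    simp only [← pow_mul, ← pow_add]
    congr 1
    ring
  have hdvd : minpoly ℤ ζ ∣ P n - P n' :=
    minpoly.isIntegrallyClosed_dvd (hζ.isIntegral hpos) (by rw [map_sub, hP, hP, he, sub_self])
  rw [hζ.minpoly_eq_pow_coprime hj] at hdvd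
  obtain ⟨C, hC⟩ := hdvd
  rw [← sub_eq_zero, ← hPj, ← hPj, ← map_sub, hC, map_mul, minpoly.aeval, zero_mul]

end TeichmullerData

/-- The digit sum and the digit factorial product modulo `3` of `r` in base `3`, encoded in one
number. -/
def ternaryInvariant (r : ℕ) : ℕ :=
  3 * (r / 27 % 3 + r / 9 % 3 + r / 3 % 3 + r % 3) +
    (r / 27 % 3).factorial * (r / 9 % 3).factorial * (r / 3 % 3).factorial *
      (r % 3).factorial % 3

theorem conj_of_ternaryInvariant_eq : ∀ a b : Fin 80, (a : ℕ) % 10 ≠ 0 → (b : ℕ) % 10 ≠ 0 →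
    (∀ m : Fin 2, ternaryInvariant ((a + 40 * m) % 80) = ternaryInvariant ((b + 40 * m) % 80)) →
    (∀ m : Fin 2, ternaryInvariant ((7 * a + 40 * m) % 80) =
      ternaryInvariant ((7 * b + 40 * m) % 80)) →
    ∃ i : Fin 4, (a : ℕ) = 3 ^ (i : ℕ) * b % 80 := by
  decide +kernel

theorem DigitAgree.ternaryInvariant_eq {n n' : ℕ} (h : DigitAgree 3 n n') :
    ternaryInvariant (n % 80) = ternaryInvariant (n' % 80) := by
  let e : ℕ → Fin 4 → ℤ := fun r =>
    ![(r / 27 % 3 : ℕ), (r / 9 % 3 : ℕ), (r / 3 % 3 : ℕ), (r % 3 : ℕ)]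
  have he : ∀ r i, 0 ≤ e r i ∧ e r i < (3 : ℕ) := by
    intro r i
    fin_cases i <;> simp only [e, Fin.zero_eta, Fin.mk_one, Fin.reduceFinMk, Matrix.cons_val] <;>
      omega
  have hv : ∀ r < 80, digitValue (3 : ℕ) (e r) = r := by
    intro r hr
    simp only [digitValue, e, Matrix.cons_val]
    omega
  have hlt : ∀ n : ℕ, n % 80 < 80 := fun n => Nat.mod_lt _ (by norm_num)
  have hmod : ∀ n : ℕ, digitValue (3 : ℕ) (e (n % 80)) ≡ n [ZMOD ((3 : ℕ) : ℤ) ^ 4 - 1] := by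
    intro n
    rw [hv _ (hlt n)]
    push_cast
    exact Int.mod_modEq _ _
  have hb : ∀ n : ℕ, digitValue (3 : ℕ) (e (n % 80)) < ((3 : ℕ) : ℤ) ^ 4 - 1 := by
    intro n
    rw [hv _ (hlt n)]
    have := hlt n
    push_cast
    omega
  obtain ⟨h1, h2⟩ := h _ _ (he (n % 80)) (he (n' % 80)) (hb n) (hb n') (hmod n) (hmod n')
  simp only [e, Fin.sum_univ_four, Fin.prod_univ_four, Matrix.cons_val, Int.toNat_natCast] at h1 h2
  exact congrArg₂ (fun s t => 3 * s + t) (by exact_mod_cast h1) h2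

theorem le_totient_sq_of_odd (n : ℕ) (hn : Odd n) : n ≤ n.totient ^ 2 := by
  induction n using Nat.recOnPosPrimePosCoprime with
  | zero => simp
  | one => simp
  | prime_pow q k hq hk =>
    have hq3 : 3 ≤ q := by
      have := hq.two_le
      rcases this.lt_or_eq with h | rfl
      · exact h
      · exact absurd hn (by simp [Nat.even_pow, hk.ne'])
    obtain ⟨k, rfl⟩ := Nat.exists_eq_succ_of_ne_zero hk.ne'
    rw [Nat.totient_prime_pow_succ hq]
    obtain ⟨r, rfl⟩ : ∃ r, q = r + 1 := ⟨q - 1, by omega⟩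
    rw [Nat.succ_eq_add_one, pow_succ, mul_pow, Nat.add_sub_cancel]
    refine Nat.mul_le_mul (Nat.le_self_pow two_ne_zero _) (by nlinarith)
  | coprime a b ha hb hab iha ihb =>
    rw [Nat.odd_mul] at hn
    rw [Nat.totient_mul hab, mul_pow]
    exact Nat.mul_le_mul (iha hn.1) (ihb hn.2)

theorem le_two_mul_totient_sq (n : ℕ) : n ≤ 2 * n.totient ^ 2 := by
  obtain rfl | hn := eq_or_ne n 0
  · simp
  obtain ⟨k, m, hm, rfl⟩ := Nat.exists_eq_two_pow_mul_odd hn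
  have h1 := le_totient_sq_of_odd m hm
  rw [Nat.totient_mul (Nat.Coprime.pow_left k (Nat.coprime_two_left.mpr hm)), mul_pow, ← mul_assoc]
  refine Nat.mul_le_mul ?_ h1
  cases k with
  | zero => simp
  | succ k =>
    rw [Nat.totient_prime_pow_succ Nat.prime_two, pow_succ, mul_pow]
    have := Nat.le_self_pow two_ne_zero (2 ^ k)
    omega

theorem lt_totient_of_prime {p : ℕ} (hp : p.Prime) (hp5 : 5 ≤ p) :
    32 < (p ^ 3 + p ^ 2 + p + 1).totient := by
  by_cases h : p < 13
  · interval_cases p <;> decide +kernel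
  · have h1 := le_two_mul_totient_sq (p ^ 3 + p ^ 2 + p + 1)
    have h2 : 13 ^ 3 ≤ p ^ 3 := Nat.pow_le_pow_left (by omega) 3
    by_contra! h3
    have h4 := Nat.pow_le_pow_left h3 2
    omega

theorem exists_coprime_modEq {p : ℕ} (hp : p.Prime) (u : (ZMod (p ^ 3 + p ^ 2 + p + 1))ˣ) :
    ∃ j : ℕ, j.Coprime (p * (p ^ 4 - 1)) ∧ j ≡ 1 [MOD p] ∧
      (j : ZMod (p ^ 3 + p ^ 2 + p + 1)) = u := by
  have hq : 16 ≤ p ^ 4 := Nat.pow_le_pow_left hp.two_le 4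
  have hN : p ^ 3 + p ^ 2 + p + 1 ∣ p ^ 4 - 1 := by
    refine ⟨p - 1, ?_⟩
    zify [hp.one_le, show 1 ≤ p ^ 4 by omega]
    ring
  have hcop : (p ^ 4 - 1).Coprime p := by
    refine ((Nat.Prime.coprime_iff_not_dvd hp).mpr fun hd => ?_).symm
    have h1 := (Nat.dvd_sub_iff_right (by omega) (dvd_pow_self p four_ne_zero)).mp hd
    exact hp.one_lt.ne' (Nat.dvd_one.mp h1)
  have : NeZero (p ^ 4 - 1) := ⟨by omega⟩
  obtain ⟨v, hv⟩ := ZMod.unitsMap_surjective hN u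
  obtain ⟨j, hj1, hj2⟩ := Nat.chineseRemainder hcop (v : ZMod (p ^ 4 - 1)).val 1
  have hjv : (j : ZMod (p ^ 4 - 1)) = v := by
    rw [(ZMod.natCast_eq_natCast_iff _ _ _).mpr hj1, ZMod.natCast_zmod_val]
  refine ⟨j, Nat.Coprime.mul_right ?_ ?_, hj2, ?_⟩
  · rw [Nat.Coprime, Nat.ModEq.gcd_eq hj2, Nat.gcd_one_left]
  · rw [← ZMod.isUnit_iff_coprime, hjv]
    exact v.isUnit
  · rw [← hv, ZMod.unitsMap_val, ← hjv, ZMod.cast_natCast hN]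

theorem IsRegularExponent.mul {p n j : ℤ} (hn : IsRegularExponent p n)
    (hj : IsCoprime (p ^ 4 - 1) j) : IsRegularExponent p (j * n) := by
  intro hd
  rw [mul_left_comm] at hd
  exact hn (hj.dvd_of_dvd_mul_left hd)

theorem conj_of_digitAgree_three {n n' : ℕ} (hn : IsRegularExponent 3 n)
    (hn' : IsRegularExponent 3 n')
    (h : ∀ j : ℕ, j.Coprime (3 * (3 ^ 4 - 1)) → j ≡ 1 [MOD 3] →
      ∀ m : ℕ, DigitAgree 3 ((j * n + m * 40 : ℕ)) ((j * n' + m * 40 : ℕ))) :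
    ∃ i : Fin 4, (n : ℤ) ≡ 3 ^ (i : ℕ) * n' [ZMOD 3 ^ 4 - 1] := by
  have hred : ∀ {n : ℕ}, IsRegularExponent 3 n → n % 80 % 10 ≠ 0 := by
    intro n hn h0
    refine hn ?_
    norm_num
    omega
  have hlt : ∀ n : ℕ, n % 80 < 80 := fun n => Nat.mod_lt _ (by norm_num)
  have key : ∀ j : ℕ, j.Coprime (3 * (3 ^ 4 - 1)) → j ≡ 1 [MOD 3] → ∀ m : Fin 2,
      ternaryInvariant ((j * (n % 80) + 40 * m) % 80) =
        ternaryInvariant ((j * (n' % 80) + 40 * m) % 80) := by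
    intro j hj hj1 m
    have := (h j hj hj1 m).ternaryInvariant_eq
    have hm : ∀ n : ℕ, (j * (n % 80) + 40 * m) % 80 = (j * n + m * 40) % 80 := fun n => by
      rw [mul_comm 40]
      exact ((Nat.mod_modEq n 80).mul_left j).add_right _
    rwa [hm, hm]
  obtain ⟨i, hi⟩ := conj_of_ternaryInvariant_eq ⟨n % 80, hlt n⟩ ⟨n' % 80, hlt n'⟩ (hred hn)
    (hred hn') (fun m => by simpa using key 1 (by norm_num) rfl m)
    (key 7 (by norm_num) rfl)
  refine ⟨i, ?_⟩
  have h1 : n ≡ 3 ^ (i : ℕ) * n' [MOD 80] :=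
    Eq.trans hi ((Nat.mod_modEq n' 80).mul_left _)
  have := Int.natCast_modEq_iff.mpr h1
  push_cast at this
  exact this

theorem conj_of_digitAgree {p : ℕ} (hp : p.Prime) {n n' : ℕ} (hn : IsRegularExponent p n)
    (hn' : IsRegularExponent p n')
    (h : ∀ j : ℕ, j.Coprime (p * (p ^ 4 - 1)) → j ≡ 1 [MOD p] → ∀ m : ℕ,
      DigitAgree p ((j * n + m * (p ^ 3 + p ^ 2 + p + 1) : ℕ))
        ((j * n' + m * (p ^ 3 + p ^ 2 + p + 1) : ℕ))) :
    ∃ i : Fin 4, (n : ℤ) ≡ p ^ (i : ℕ) * n' [ZMOD p ^ 4 - 1] := by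
  obtain rfl | hp3 := eq_or_ne p 3
  · exact conj_of_digitAgree_three hn hn' h
  have hq : 16 ≤ p ^ 4 := Nat.pow_le_pow_left hp.two_le 4
  have hcast : ((p ^ 4 - 1 : ℕ) : ℤ) = (p : ℤ) ^ 4 - 1 := by
    push_cast [show 1 ≤ p ^ 4 by omega]
    rfl
  have hp1 : (0 : ℤ) < p - 1 := by have := hp.two_le; omega
  have hQ : (p : ℤ) ^ 4 - 1 = (p - 1) * ((p ^ 3 + p ^ 2 + p + 1 : ℕ) : ℤ) := by push_cast; ring
  by_contra hno
  have hex : ∀ j : ℕ, j.Coprime (p * (p ^ 4 - 1)) → j ≡ 1 [MOD p] →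
      3 ≤ p ∧ ∃ t : Fin 4 × Fin 4 × Bool,
        (j : ℤ) * (n - p ^ (t.1 : ℕ) * n') ≡
          (if t.2.2 then 1 else -1) * ((p - 1) * p ^ (t.2.1 : ℕ)) [ZMOD p ^ 4 - 1] := by
    intro j hj hj1
    have hjQ : IsCoprime ((p : ℤ) ^ 4 - 1) (j : ℤ) := by
      rw [← hcast]
      exact (Nat.isCoprime_iff_coprime.mpr hj.coprime_mul_left_right).symm
    rcases conj_or_exceptional hp (hn.mul hjQ) (hn'.mul hjQ)
      (fun m => by exact_mod_cast h j hj hj1 m) with ⟨i, hi⟩ | ⟨h3, i, c, ε, hε, he⟩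
    · refine absurd ⟨i, ?_⟩ hno
      rw [Int.modEq_iff_dvd] at hi ⊢
      refine hjQ.dvd_of_dvd_mul_left ?_
      refine hi.trans (dvd_of_eq ?_)
      ring
    · have hmul : (j : ℤ) * (n - p ^ (i : ℕ) * n') = j * n - p ^ (i : ℕ) * (j * n') := by ring
      rcases hε with rfl | rfl
      · exact ⟨h3, (i, c, true), by simpa [hmul] using he⟩
      · exact ⟨h3, (i, c, false), by simpa [hmul] using he⟩
  have hp5 : 5 ≤ p := by
    have h3 := (hex 1 (Nat.coprime_one_left _) rfl).1
    by_contra! h5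
    have : p = 4 := by omega
    exact absurd hp (by rw [this]; norm_num)
  choose J hJ hJ1 hJu using exists_coprime_modEq hp
  choose T hT using fun u => (hex (J u) (hJ u) (hJ1 u)).2
  have hinj : Function.Injective T := by
    intro u v huv
    have h1 := hT u
    have h2 := hT v
    rw [← huv] at h2
    set D : ℤ := n - p ^ ((T u).1 : ℕ) * n'
    set ε : ℤ := if (T u).2.2 then 1 else -1 with hε
    have hε2 : ε * ε = 1 := by rw [hε]; split_ifs <;> rfl
    set c : ℕ := ((T u).2.1 : ℕ)
    have h3 : ((p : ℤ) ^ 4 - 1) ∣ ((J u : ℤ) - J v) * D := by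
      have := (h1.trans h2.symm).symm.dvd
      rwa [← sub_mul] at this
    have h4 : ((p : ℤ) ^ 4 - 1) ∣ (p : ℤ) ^ c * ((p - 1) * (J u - J v)) := by
      have h5 := Dvd.dvd.mul_left h1.symm.dvd (((J u : ℤ) - J v) * ε)
      have h6 := dvd_sub (Dvd.dvd.mul_left h3 (J u * ε)) h5
      refine h6.trans (dvd_of_eq ?_)
      linear_combination (((p : ℤ) ^ c * ((p - 1) * (J u - J v)))) * hε2
    have h5 := (isCoprime_pow_sub_one (p : ℤ) c).dvd_of_dvd_mul_left h4
    rw [hQ] at h5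
    have h6 := Int.dvd_of_mul_dvd_mul_left hp1.ne' h5
    have h7 : ((J v : ℤ) : ZMod (p ^ 3 + p ^ 2 + p + 1)) = (J u : ℤ) :=
      (ZMod.intCast_eq_intCast_iff_dvd_sub _ _ _).mpr h6
    ext
    rw [← hJu, ← hJu]
    exact_mod_cast h7.symm
  have hcard := Fintype.card_le_of_injective T hinj
  rw [ZMod.card_units_eq_totient] at hcard
  simp only [Fintype.card_prod, Fintype.card_fin, Fintype.card_bool] at hcard
  have := lt_totient_of_prime hp hp5
  omega

theorem gauss_sum_converse_GL_four
    (p : ℕ) [hp : Fact p.Prime]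
    (E : Type) [Field E] [Fintype E] [Algebra (ZMod p) E]
    (hE : Fintype.card E = p ^ 4)
    (ψ : AddChar (ZMod p) ℂ) (hψ : ψ ≠ 1)
    (χ₁ χ₂ : Eˣ →* ℂˣ) (hχ₁ : IsRegularChar χ₁) (hχ₂ : IsRegularChar χ₂)
    (h : ∀ η : (ZMod p)ˣ →* ℂˣ,
      twistedGaussSum (ZMod p) χ₁ η ψ = twistedGaussSum (ZMod p) χ₂ η ψ) :
    ∃ j : ℕ, ∀ x : Eˣ, χ₁ x = χ₂ (x ^ p ^ j) := by
  obtain ⟨k, _, φ, ι, θ, Ψ, hD, hΨ⟩ := exists_teichmullerData hE hψ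
  obtain ⟨n₁, hn₁⟩ := hD.exists_exponent χ₁
  obtain ⟨n₂, hn₂⟩ := hD.exists_exponent χ₂
  have hq := hD.sixteen_le
  have hgauss : ∀ m, TeichmullerData.gauss θ Ψ (n₁ + m * (p ^ 3 + p ^ 2 + p + 1)) =
      TeichmullerData.gauss θ Ψ (n₂ + m * (p ^ 3 + p ^ 2 + p + 1)) := by
    intro m
    apply Subtype.ext
    rw [← hD.twistedGaussSum_eq hΨ hn₁, ← hD.twistedGaussSum_eq hΨ hn₂]
    exact h _
  obtain ⟨i, hi⟩ := conj_of_digitAgree hp.out (hD.isRegularExponent hn₁ hχ₁)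
    (hD.isRegularExponent hn₂ hχ₂) fun j hj hj1 m => by
      refine hD.digitAgree_of_gauss_eq ?_
      obtain ⟨l, -, hl⟩ := Nat.exists_mul_mod_eq_one_of_coprime hj.coprime_mul_left_right
        (by omega)
      have hlm : j * (l * m) ≡ m [MOD p ^ 4 - 1] := by
        have h1 : j * l ≡ 1 [MOD p ^ 4 - 1] := by
          rw [Nat.ModEq, hl, Nat.mod_eq_of_lt (by omega)]
        simpa [mul_assoc] using h1.mul_right m
      have key : ∀ n, TeichmullerData.gauss θ Ψ (j * n + m * (p ^ 3 + p ^ 2 + p + 1)) =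
          TeichmullerData.gauss θ Ψ (j * (n + l * m * (p ^ 3 + p ^ 2 + p + 1))) := by
        intro n
        refine hD.gauss_mod ?_
        rw [mul_add j, ← mul_assoc j (l * m)]
        exact (hlm.symm.mul_right _).add_left _
      rw [key, key]
      exact hD.gauss_mul_coprime hj hj1 (hgauss _)
  refine ⟨i, fun x => ?_⟩
  have hi' : n₁ ≡ p ^ (i : ℕ) * n₂ [MOD p ^ 4 - 1] := by
    rw [← Int.natCast_modEq_iff]
    push_cast [show 1 ≤ p ^ 4 by omega]
    exact hi
  have hx : (θ x : ℂ) ^ (p ^ 4 - 1) = 1 := by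
    have h1 : θ x ^ (p ^ 4 - 1) = 1 := by
      rw [← MulChar.pow_apply_coe, hD.char_pow_eq_one, MulChar.one_apply_coe]
    exact congrArg Subtype.val h1
  ext
  rw [hn₁, hn₂, Units.val_pow_eq_pow_val, map_pow, SubmonoidClass.coe_pow, ← pow_mul]
  exact pow_eq_pow_of_modEq hi' hx
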